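/- arXiv:0810.0654 — 2 statements merged into one kernel-verified Lean document; each statement's English description precedes it below -/
import Mathlib

section
/- (i) For any γ ≥ 0 if p > 2, and for any γ ∈ [0, δ) if p < 2, every solution w of equation (E) on an interval [r₀,∞) satisfies w(r) = O(r^{-γ}) + O(r^{-α}) as r → ∞. (ii) The global solution w(·,a) satisfies |w(r,a)| ≤ C_γ(a) ((1+r)^{-γ} + (1+r)^{-α}) for all r ≥ 0, where a ↦ C_γ(a) is continuous on ℝ. -/
open Set Filter Topology Asymptotics

/-- The p-Laplacian nonlinearity φ_p(x) = |x|^{p-2} x. -/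
noncomputable def phiP (p x : ℝ) : ℝ := |x| ^ (p - 2) * x

/-- `w` is a solution of equation (E) on the interval `I ⊆ (0,∞)`:
`w` is C¹ on `I`, `|w'|^{p-2} w'` is C¹ on `I`, and the equation
`(|w'|^{p-2}w')' + ((N-1)/r)|w'|^{p-2}w' + r w' + α w + |w|^{q-1} w = 0`
holds on `I` (derivatives taken within `I`). -/
def IsSolutionOn (N : ℕ) (p q α : ℝ) (w : ℝ → ℝ) (I : Set ℝ) : Prop :=
  ContDiffOn ℝ 1 w I ∧
  ContDiffOn ℝ 1 (fun r => phiP p (derivWithin w I r)) I ∧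
  ∀ r ∈ I,
    derivWithin (fun s => phiP p (derivWithin w I s)) I r
      + ((N : ℝ) - 1) / r * phiP p (derivWithin w I r)
      + r * derivWithin w I r + α * w r + |w r| ^ (q - 1) * w r = 0

/-- `w` is the global solution of (E) on `[0,∞)` with `w(0) = a`, `w'(0) = 0`:
`w ∈ C¹([0,∞))`, `|w'|^{p-2}w' ∈ C¹([0,∞))`, and (E) holds on `(0,∞)`. -/
def IsGlobalSolution (N : ℕ) (p q α a : ℝ) (w : ℝ → ℝ) : Prop :=
  ContDiffOn ℝ 1 w (Ici 0) ∧
  ContDiffOn ℝ 1 (fun r => phiP p (derivWithin w (Ici 0) r)) (Ici 0) ∧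
  (∀ r ∈ Ioi (0 : ℝ),
    derivWithin (fun s => phiP p (derivWithin w (Ici 0) s)) (Ici 0) r
      + ((N : ℝ) - 1) / r * phiP p (derivWithin w (Ici 0) r)
      + r * derivWithin w (Ici 0) r + α * w r + |w r| ^ (q - 1) * w r = 0) ∧
  w 0 = a ∧ derivWithin w (Ici 0) 0 = 0

/-- `r` is an isolated zero of `w` relative to the set `I`. -/
def IsIsolatedZeroOn (w : ℝ → ℝ) (I : Set ℝ) (r : ℝ) : Prop :=
  r ∈ I ∧ w r = 0 ∧ ∀ᶠ s in 𝓝[I \ {r}] r, w s ≠ 0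

/-- `w` has at least `n` isolated zeros in `(0,∞)`. -/
def HasAtLeastIsolatedZeros (w : ℝ → ℝ) (n : ℕ) : Prop :=
  ∃ z : Fin n → ℝ, StrictMono z ∧ ∀ i, 0 < z i ∧ IsIsolatedZeroOn w (Ici 0) (z i)

/-- `(w, v)` with `v = w'` solves (E) on `(r₀, ∞)`, continuously up to `r₀`. -/
def SolvesPhaseSystem (N : ℕ) (p q α : ℝ) (w v : ℝ → ℝ) (r₀ : ℝ) : Prop :=
  ContinuousOn w (Ici r₀) ∧ ContinuousOn (fun r => phiP p (v r)) (Ici r₀) ∧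
  ∀ r, r₀ < r → HasDerivAt w (v r) r ∧
    HasDerivAt (fun s => phiP p (v s))
      (-(((N : ℝ) - 1) / r * phiP p (v r) + r * v r + α * w r + |w r| ^ (q - 1) * w r)) r

/-- The energy associated with (E). -/
noncomputable def energy (p q α x y : ℝ) : ℝ :=
  (p - 1) / p * |y| ^ p + α * x ^ 2 / 2 + |x| ^ (q + 1) / (q + 1)

section PhiP

variable {p : ℝ}

lemma mul_phiP (hp : 1 < p) (x : ℝ) : x * phiP p x = |x| ^ p := by
  rcases eq_or_ne x 0 with rfl | hx
  · simp [Real.zero_rpow (by linarith : p ≠ 0)]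
  · have h : 0 < |x| := abs_pos.2 hx
    rw [phiP, show p = (p - 2) + 2 by ring, Real.rpow_add h]
    simp only [add_sub_cancel_right, Real.rpow_two, sq_abs]
    ring

lemma abs_phiP (hp : 1 < p) (x : ℝ) : |phiP p x| = |x| ^ (p - 1) := by
  rcases eq_or_ne x 0 with rfl | hx
  · simp [phiP, Real.zero_rpow (by linarith : p - 1 ≠ 0)]
  · have h : 0 < |x| := abs_pos.2 hx
    rw [phiP, abs_mul, abs_of_nonneg (by positivity), show p - 1 = (p - 2) + 1 by ring,
      Real.rpow_add h, Real.rpow_one]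

lemma phiP_sq (hp : 1 < p) (x : ℝ) : phiP p x ^ 2 = |x| ^ (2 * p - 2) := by
  rw [← sq_abs, abs_phiP hp, ← Real.rpow_natCast, ← Real.rpow_mul (abs_nonneg x)]
  congr 1
  push_cast
  ring

lemma abs_phiP_rpow_conj (hp : 1 < p) (x : ℝ) : |phiP p x| ^ (p / (p - 1)) = |x| ^ p := by
  rw [abs_phiP hp, ← Real.rpow_mul (abs_nonneg x)]
  congr 1
  field_simp [(by linarith : p - 1 ≠ 0)]

lemma phiP_conj_phiP (hp : 1 < p) (x : ℝ) :
    |phiP p x| ^ (p / (p - 1) - 2) * phiP p x = x := by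
  rcases eq_or_ne x 0 with rfl | hx
  · simp [phiP]
  · have h : 0 < |x| := abs_pos.2 hx
    rw [abs_phiP hp, ← Real.rpow_mul (abs_nonneg x), phiP, ← mul_assoc, ← Real.rpow_add h]
    have : (p - 1) * (p / (p - 1) - 2) + (p - 2) = 0 := by
      field_simp [(by linarith : p - 1 ≠ 0)]
      ring
    rw [this, Real.rpow_zero, one_mul]

end PhiP

section Energy

variable {N : ℕ} {p q α : ℝ} {w v : ℝ → ℝ} {r₀ : ℝ}

lemma energy_eq_phiP (hp : 1 < p) (x y : ℝ) :
    energy p q α x y =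
      (p - 1) / p * |phiP p y| ^ (p / (p - 1)) + α * x ^ 2 / 2 + |x| ^ (q + 1) / (q + 1) := by
  rw [abs_phiP_rpow_conj hp, energy]

lemma SolvesPhaseSystem.hasDerivAt_energy (hp : 1 < p) (hq : 1 < q)
    (h : SolvesPhaseSystem N p q α w v r₀) {r : ℝ} (hr : r₀ < r) :
    HasDerivAt (fun s => energy p q α (w s) (v s))
      (-(((N : ℝ) - 1) / r * |v r| ^ p) - r * v r ^ 2) r := by
  obtain ⟨hw, hy⟩ := h.2.2 r hr
  have hp1 : p - 1 ≠ 0 := by linarith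
  have hp0 : p ≠ 0 := by linarith
  have hs : 1 < p / (p - 1) := by
    rw [lt_div_iff₀ (by linarith)]
    linarith
  simp only [energy_eq_phiP hp]
  have h1 := ((hasDerivAt_abs_rpow (phiP p (v r)) hs).comp r hy).const_mul ((p - 1) / p)
  have h2 := ((hw.pow 2).const_mul α).div_const 2
  have h3 := ((hasDerivAt_abs_rpow (w r) (by linarith : 1 < q + 1)).comp r hw).div_const (q + 1)
  refine ((h1.add h2).add h3).congr_deriv ?_
  have e1 := phiP_conj_phiP hp (v r)
  have e2 := mul_phiP hp (v r)
  rw [← e2, show q + 1 - 2 = q - 1 by ring]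
  have : (p - 1) / p * (p / (p - 1) * |phiP p (v r)| ^ (p / (p - 1) - 2) * phiP p (v r) *
      -(((N : ℝ) - 1) / r * phiP p (v r) + r * v r + α * w r + |w r| ^ (q - 1) * w r))
      = v r * -(((N : ℝ) - 1) / r * phiP p (v r) + r * v r + α * w r
          + |w r| ^ (q - 1) * w r) := by
    rw [mul_assoc (p / (p - 1)), e1]
    field_simp
  rw [this]
  have hq1 : q + 1 ≠ 0 := by linarith
  field_simp
  push_cast
  ring

lemma SolvesPhaseSystem.continuousOn_energy (hp : 1 < p) (hq : 1 < q)
    (h : SolvesPhaseSystem N p q α w v r₀) :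
    ContinuousOn (fun s => energy p q α (w s) (v s)) (Ici r₀) := by
  simp only [energy_eq_phiP hp]
  have hs : 0 ≤ p / (p - 1) := div_nonneg (by linarith) (by linarith)
  have h1 := h.1
  have h2 := (h.2.1.abs.rpow_const fun _ _ => Or.inr hs)
  have h3 := (h.1.abs.rpow_const fun _ _ => Or.inr (by linarith : 0 ≤ q + 1))
  fun_prop

lemma SolvesPhaseSystem.antitoneOn_energy (hN : 1 ≤ N) (hp : 1 < p) (hq : 1 < q) (hr₀ : 0 ≤ r₀)
    (h : SolvesPhaseSystem N p q α w v r₀) :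
    AntitoneOn (fun s => energy p q α (w s) (v s)) (Ici r₀) := by
  refine antitoneOn_of_hasDerivWithinAt_nonpos (convex_Ici r₀) (h.continuousOn_energy hp hq)
    (fun r hr => (h.hasDerivAt_energy hp hq (by simpa using hr)).hasDerivWithinAt) ?_
  intro r hr
  have hr : r₀ < r := by simpa using hr
  have hN' : (0 : ℝ) ≤ (N : ℝ) - 1 := by
    have : (1 : ℝ) ≤ N := by exact_mod_cast hN
    linarith
  have hr' : 0 < r := by linarith
  have : 0 ≤ ((N : ℝ) - 1) / r * |v r| ^ p := by positivity
  have : 0 ≤ r * v r ^ 2 := by positivity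
  linarith

/-- Sublevel sets of the energy are bounded. -/
lemma exists_abs_le_of_energy_le (hp : 1 < p) (hq : 1 < q) (hα : 0 < α) (B : ℝ) :
    ∃ M : ℝ, 0 ≤ M ∧ ∀ x y, energy p q α x y ≤ B → |x| ≤ M ∧ |y| ≤ M := by
  refine ⟨max (√(2 * B / α)) ((p * B / (p - 1)) ^ p⁻¹), le_max_of_le_left (by positivity), ?_⟩
  intro x y hxy
  unfold energy at hxy
  have hp1 : 0 < p - 1 := by linarith
  have hp0 : 0 < p := by linarith
  have hq1 : 0 < q + 1 := by linarith
  have t1 : 0 ≤ (p - 1) / p * |y| ^ p := by positivity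
  have t2 : 0 ≤ α * x ^ 2 / 2 := by positivity
  have t3 : 0 ≤ |x| ^ (q + 1) / (q + 1) := by positivity
  refine ⟨le_max_of_le_left (Real.abs_le_sqrt ?_), le_max_of_le_right ?_⟩
  · rw [le_div_iff₀ hα]
    linarith
  · have hB : (p - 1) / p * |y| ^ p ≤ B := by linarith
    have : |y| ^ p ≤ p * B / (p - 1) := by
      rw [le_div_iff₀ hp1]
      have := mul_le_mul_of_nonneg_left hB hp0.le
      have e : p * ((p - 1) / p * |y| ^ p) = |y| ^ p * (p - 1) := by field_simp
      linarith
    calc |y| = (|y| ^ p) ^ p⁻¹ := (Real.rpow_rpow_inv (abs_nonneg y) hp0.ne').symm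
      _ ≤ _ := Real.rpow_le_rpow (by positivity) this (by positivity)

end Energy

/-- A Young-type inequality with a parameter `r`, uniform for `x` in a bounded interval. -/
lemma exists_mul_rpow_le {m n b e A ε M : ℝ} (hm : 0 < m) (hb : 0 < b) (hA : 0 ≤ A)
    (hε : 0 < ε) (h : n ≤ m ∨ m < n ∧ e ≤ b * m / (n - m)) :
    ∃ R C : ℝ, 0 ≤ C ∧ ∀ r x : ℝ, 1 ≤ r → R ≤ r → 0 ≤ x → x ≤ M →
      A * x ^ m ≤ ε * r ^ b * x ^ n + C * r ^ (-e) := by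
  rcases h with h | ⟨h, he⟩
  · obtain ⟨R, hR⟩ := ((tendsto_rpow_atTop hb).eventually_ge_atTop
      (A * M ^ (m - n) / ε)).exists_forall_of_atTop
    refine ⟨R, 0, le_rfl, fun r x hr1 hr hx hxM => ?_⟩
    have hrb := hR r hr
    rw [div_le_iff₀ hε] at hrb
    have hr0 : 0 < r := by linarith
    rcases hx.eq_or_lt with rfl | hx
    · rw [Real.zero_rpow hm.ne']
      have : (0 : ℝ) ≤ 0 ^ n := Real.rpow_nonneg le_rfl n
      simp only [mul_zero, zero_mul, add_zero]
      positivity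
    · have e1 : x ^ m = x ^ (m - n) * x ^ n := by rw [← Real.rpow_add hx]; congr 1; ring
      have e2 : x ^ (m - n) ≤ M ^ (m - n) := Real.rpow_le_rpow hx.le hxM (by linarith)
      have e3 : A * x ^ (m - n) ≤ ε * r ^ b := by
        have := mul_le_mul_of_nonneg_left e2 hA
        linarith
      rw [e1, ← mul_assoc, zero_mul, add_zero]
      exact mul_le_mul_of_nonneg_right e3 (by positivity)
  · refine ⟨1, A * (A / ε) ^ (m / (n - m)), by positivity, fun r x hr _ hx _ => ?_⟩
    have hr0 : 0 < r := by linarith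
    by_cases hc : A * x ^ m ≤ ε * r ^ b * x ^ n
    · have : 0 ≤ A * (A / ε) ^ (m / (n - m)) * r ^ (-e) := by positivity
      linarith
    push Not at hc
    have hx : 0 < x := by
      rcases hx.eq_or_lt with rfl | hx
      · simp [Real.zero_rpow hm.ne', Real.zero_rpow (hm.trans h).ne'] at hc
      · exact hx
    have hnm : 0 < n - m := by linarith
    have e1 : x ^ n = x ^ (n - m) * x ^ m := by rw [← Real.rpow_add hx]; congr 1; ring
    have hlt : ε * r ^ b * x ^ (n - m) < A := by
      rw [e1, ← mul_assoc] at hc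
      exact lt_of_mul_lt_mul_right hc (by positivity)
    have e2 : x ^ (n - m) ≤ A / ε * r ^ (-b) := by
      rw [Real.rpow_neg hr0.le, ← div_eq_mul_inv, le_div_iff₀ (by positivity), le_div_iff₀ hε]
      linarith
    have e3 : x ^ m ≤ (A / ε) ^ (m / (n - m)) * r ^ (-e) := by
      calc x ^ m = (x ^ (n - m)) ^ (m / (n - m)) := by
            rw [← Real.rpow_mul hx.le]; congr 1; field_simp
        _ ≤ (A / ε * r ^ (-b)) ^ (m / (n - m)) :=
            Real.rpow_le_rpow (by positivity) e2 (by positivity)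
        _ = (A / ε) ^ (m / (n - m)) * r ^ (-(b * m / (n - m))) := by
            rw [Real.mul_rpow (by positivity) (by positivity), ← Real.rpow_mul hr0.le]
            congr 2; ring
        _ ≤ _ := by
            gcongr
    have : 0 ≤ ε * r ^ b * x ^ n := by positivity
    have := mul_le_mul_of_nonneg_left e3 hA
    linarith

/-- The Lyapunov function measuring decay of order `r ^ (-d)`. -/
noncomputable def lyapunov (p q α d η r x y : ℝ) : ℝ :=
  r ^ (2 * d - 2 * η) * energy p q α x y + r ^ (2 * d) * (x ^ 2 / 2) +
    r ^ (2 * d - 1) * (x * phiP p y)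

section Lyapunov

variable {N : ℕ} {p q α d η : ℝ} {w v : ℝ → ℝ} {R : ℝ}

lemma abs_rpow_add_one (hq : 1 < q) (x : ℝ) : |x| ^ (q + 1) = |x| ^ (q - 1) * x ^ 2 := by
  rcases eq_or_ne x 0 with h0 | h0
  · simp [h0, Real.zero_rpow (by linarith : q + 1 ≠ 0)]
  · rw [← sq_abs, ← Real.rpow_natCast, ← Real.rpow_add (abs_pos.2 h0)]
    congr 1; push_cast; ring

lemma SolvesPhaseSystem.hasDerivAt_lyapunov (hp : 1 < p) (hq : 1 < q)
    (h : SolvesPhaseSystem N p q α w v R) {r : ℝ} (hr0 : 0 < r) (hr : R < r) :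
    HasDerivAt (fun s => lyapunov p q α d η s (w s) (v s))
      (r ^ (2 * d - 1) * ((2 * d - 2 * η) * r ^ (-2 * η) * energy p q α (w r) (v r)
        + r ^ (-2 * η) * (-(((N : ℝ) - 1) * |v r| ^ p) - r ^ 2 * v r ^ 2)
        + |v r| ^ p - |w r| ^ (q + 1) - (α - d) * w r ^ 2
        + (2 * d - N) * (w r * phiP p (v r) / r))) r := by
  obtain ⟨hw, hy⟩ := h.2.2 r hr
  have hpow (e : ℝ) := Real.hasDerivAt_rpow_const (x := r) (p := e) (Or.inl hr0.ne')
  have h1 := (hpow (2 * d - 2 * η)).mul (h.hasDerivAt_energy hp hq hr)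
  have h2 := (hpow (2 * d)).mul ((hw.pow 2).div_const 2)
  have h3 := (hpow (2 * d - 1)).mul (hw.mul hy)
  refine ((h1.add h2).add h3).congr_deriv ?_
  have e1 : r ^ (2 * d - 2 * η - 1) = r ^ (2 * d - 1) * r ^ (-2 * η) := by
    rw [← Real.rpow_add hr0]; congr 1; ring
  have e2 : r ^ (2 * d - 2 * η) = r ^ (2 * d - 1) * r ^ (-2 * η) * r := by
    rw [← Real.rpow_add hr0, ← Real.rpow_add_one hr0.ne']; congr 1; ring
  have e3 : r ^ (2 * d) = r ^ (2 * d - 1) * r := by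
    rw [← Real.rpow_add_one hr0.ne']; congr 1; ring
  have e4 : r ^ (2 * d - 1 - 1) = r ^ (2 * d - 1) / r := by
    rw [Real.rpow_sub_one hr0.ne']
  rw [e1, e2, e3, e4, abs_rpow_add_one hq, ← mul_phiP hp (v r)]
  simp only [Pi.mul_apply, Pi.pow_apply]
  generalize energy p q α (w r) (v r) = E
  generalize r ^ (-2 * η) = S
  generalize r ^ (2 * d - 1) = T
  generalize phiP p (v r) = y
  field_simp
  push_cast
  ring

lemma SolvesPhaseSystem.continuousOn_lyapunov (hp : 1 < p) (hq : 1 < q) (hR : 0 < R)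
    (h : SolvesPhaseSystem N p q α w v R) :
    ContinuousOn (fun s => lyapunov p q α d η s (w s) (v s)) (Ici R) := by
  have hpow (e : ℝ) : ContinuousOn (fun s : ℝ => s ^ e) (Ici R) :=
    continuousOn_id.rpow_const fun s hs => Or.inl (hR.trans_le hs).ne'
  have h1 := (hpow (2 * d - 2 * η)).mul (h.continuousOn_energy hp hq)
  have h2 := (hpow (2 * d)).mul ((h.1.pow 2).div_const 2)
  have h3 := (hpow (2 * d - 1)).mul (h.1.mul h.2.1)
  exact (h1.add h2).add h3

/-- A pointwise coercivity estimate for the Lyapunov function. -/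
lemma lyapunov_lower_bound (hp : 1 < p) (hq : 1 < q) (hα : 0 < α) {r x y C : ℝ} (hr : 0 < r)
    (hY : 1 * |y| ^ (2 * p - 2) ≤ (p - 1) / p * r ^ (2 - 2 * η) * |y| ^ p
      + C * r ^ (-(2 * d - 2))) :
    r ^ (2 * d) * x ^ 2 ≤ 4 * (lyapunov p q α d η r x y + C) := by
  have e1 : r ^ (2 * d - 2 * η) = r ^ (2 * d) * (r ^ (2 - 2 * η) / r ^ 2) := by
    rw [← Real.rpow_natCast, ← Real.rpow_sub hr, ← Real.rpow_add hr]; congr 1; push_cast; ring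
  have e2 : r ^ (-(2 * d - 2)) = r ^ 2 / r ^ (2 * d) := by
    rw [← Real.rpow_natCast, ← Real.rpow_sub hr]; congr 1; push_cast; ring
  have e3 : r ^ (2 * d - 1) = r ^ (2 * d) / r := Real.rpow_sub_one hr.ne' _
  have hE : (p - 1) / p * |y| ^ p ≤ energy p q α x y := by
    have : 0 < q + 1 := by linarith
    have : 0 ≤ α * x ^ 2 / 2 + |x| ^ (q + 1) / (q + 1) := by positivity
    unfold energy
    linarith
  have hT : 0 < r ^ (2 * d) := by positivity
  have hS : 0 < r ^ (2 - 2 * η) := by positivity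
  unfold lyapunov
  rw [e1, e3]
  rw [e2, ← phiP_sq hp] at hY
  generalize energy p q α x y = E at *
  generalize phiP p y = z at *
  generalize r ^ (2 * d) = T at *
  generalize r ^ (2 - 2 * η) = S at *
  generalize |y| ^ p = P at *
  have k1 : S / r ^ 2 * ((p - 1) / p * P) ≤ S / r ^ 2 * E :=
    mul_le_mul_of_nonneg_left hE (by positivity)
  have k2 : z ^ 2 / r ^ 2 ≤ S / r ^ 2 * ((p - 1) / p * P) + C / T := by
    have := div_le_div_of_nonneg_right hY (by positivity : 0 ≤ r ^ 2)
    have e : ((p - 1) / p * S * P + C * (r ^ 2 / T)) / r ^ 2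
        = S / r ^ 2 * ((p - 1) / p * P) + C / T := by field_simp
    rw [e, one_mul] at this
    exact this
  have k3 : -(x ^ 2 / 4 + z ^ 2 / r ^ 2) ≤ x * z / r := by
    have : x ^ 2 / 4 + z ^ 2 / r ^ 2 + x * z / r = (x / 2 + z / r) ^ 2 := by ring
    nlinarith [sq_nonneg (x / 2 + z / r)]
  have k4 : x ^ 2 / 4 ≤ S / r ^ 2 * E + x ^ 2 / 2 + x * z / r + C / T := by linarith
  have k5 := mul_le_mul_of_nonneg_left k4 hT.le
  have k6 : T * (S / r ^ 2 * E + x ^ 2 / 2 + x * z / r + C / T)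
      = T * (S / r ^ 2) * E + T * (x ^ 2 / 2) + T / r * (x * z) + C := by field_simp
  linarith

lemma abs_mul_div_le (x z : ℝ) {r U : ℝ} (hU : 0 < U) (hr : 0 < r) :
    |x * z / r| ≤ U * x ^ 2 + z ^ 2 / (U * r ^ 2) := by
  have c1 : x * z / r = U * (x * (z / (U * r))) := by field_simp
  have c2 : U * x ^ 2 + z ^ 2 / (U * r ^ 2) = U * (x ^ 2 + (z / (U * r)) ^ 2) := by
    field_simp
  rw [c1, c2, abs_mul, abs_of_pos hU]
  refine mul_le_mul_of_nonneg_left ?_ hU.le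
  generalize z / (U * r) = b
  rw [abs_le]
  constructor <;> nlinarith [sq_nonneg (x + b), sq_nonneg (x - b)]

/-- A pointwise bound for the derivative of the Lyapunov function along solutions. -/
lemma lyapunov_deriv_bound (hN : 1 ≤ N) (hp : 1 < p) (hq : 1 < q) (hd : 0 ≤ d)
    (hdα : d ≤ α) (hη : 0 < η) {r x y C₁ C₂ M : ℝ} (hr : 1 ≤ r) (hx : |x| ≤ M)
    (hY₁ : (2 * d + 1) * |y| ^ p ≤ 1 / 2 * r ^ (2 - 2 * η) * |y| ^ (2 : ℝ)
      + C₁ * r ^ (-(2 * d + η)))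
    (hY₂ : |2 * d - N| * |y| ^ (2 * p - 2) ≤ 1 / 2 * r ^ (4 - 3 * η) * |y| ^ (2 : ℝ)
      + C₂ * r ^ (-(2 * d + 2 * η - 2))) :
    r ^ (2 * d - 1) * ((2 * d - 2 * η) * r ^ (-2 * η) * energy p q α x y
        + r ^ (-2 * η) * (-(((N : ℝ) - 1) * |y| ^ p) - r ^ 2 * y ^ 2)
        + |y| ^ p - |x| ^ (q + 1) - (α - d) * x ^ 2 + (2 * d - N) * (x * phiP p y / r)) ≤
      r ^ (-1 - η) * ((2 * d * (α / 2 + M ^ (q - 1) / (q + 1)) + |2 * d - N|)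
        * (r ^ (2 * d) * x ^ 2) + (C₁ + C₂)) := by
  have hr0 : 0 < r := by linarith
  have hα : 0 ≤ α := hd.trans hdα
  set K := α / 2 + M ^ (q - 1) / (q + 1) with hK
  have hM : 0 ≤ M := (abs_nonneg x).trans hx
  have hq1 : 0 < q + 1 := by linarith
  have hp1 : 0 ≤ p - 1 := by linarith
  have hp0 : 0 < p := by linarith
  have hN' : (0 : ℝ) ≤ (N : ℝ) - 1 := by
    have : (1 : ℝ) ≤ N := by exact_mod_cast hN
    linarith
  have hxq : |x| ^ (q + 1) ≤ M ^ (q - 1) * x ^ 2 := by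
    rw [abs_rpow_add_one hq]
    gcongr
  have hxq0 : 0 ≤ |x| ^ (q + 1) := by positivity
  have hP0 : 0 ≤ |y| ^ p := by positivity
  have hE0 : 0 ≤ energy p q α x y := by unfold energy; positivity
  have hE : energy p q α x y ≤ |y| ^ p + K * x ^ 2 := by
    have a1 : (p - 1) / p * |y| ^ p ≤ |y| ^ p := by
      refine mul_le_of_le_one_left hP0 ?_
      rw [div_le_one hp0]
      linarith
    have a2 : |x| ^ (q + 1) / (q + 1) ≤ M ^ (q - 1) * x ^ 2 / (q + 1) := by gcongr
    have a3 : K * x ^ 2 = α * x ^ 2 / 2 + M ^ (q - 1) * x ^ 2 / (q + 1) := by rw [hK]; ring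
    unfold energy
    linarith
  have hS0 : 0 < r ^ (-2 * η) := by positivity
  have hS1 : r ^ (-2 * η) ≤ 1 := Real.rpow_le_one_of_one_le_of_nonpos hr (by linarith)
  have hSU : r ^ (-2 * η) ≤ r ^ (-η) := Real.rpow_le_rpow_of_exponent_le hr (by linarith)
  have e1 : r ^ (2 - 2 * η) = r ^ 2 * r ^ (-2 * η) := by
    rw [← Real.rpow_natCast, ← Real.rpow_add hr0]; congr 1; push_cast; ring
  have e2 : r ^ (4 - 3 * η) = r ^ 2 * (r ^ 2 * r ^ (-2 * η)) * r ^ (-η) := by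
    rw [← Real.rpow_natCast, ← Real.rpow_add hr0, ← Real.rpow_add hr0, ← Real.rpow_add hr0]
    congr 1; push_cast; ring
  have e3 : r ^ (-(2 * d + η)) = r ^ (-η) / r ^ (2 * d) := by
    rw [← Real.rpow_sub hr0]; congr 1; ring
  have e4 : r ^ (-(2 * d + 2 * η - 2)) = r ^ 2 * (r ^ (-η) * r ^ (-η)) / r ^ (2 * d) := by
    rw [← Real.rpow_natCast, ← Real.rpow_add hr0, ← Real.rpow_add hr0, ← Real.rpow_sub hr0]
    congr 1; push_cast; ring
  have e5 : r ^ (2 * d - 1) = r ^ (2 * d) / r := Real.rpow_sub_one hr0.ne' _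
  have e6 : r ^ (-1 - η) = r ^ (-η) / r := by
    rw [← Real.rpow_sub_one hr0.ne']; congr 1; ring
  have hU : 0 < r ^ (-η) := by positivity
  have hT : 0 < r ^ (2 * d) := by positivity
  rw [Real.rpow_two, sq_abs] at hY₁ hY₂
  rw [← phiP_sq hp, e2, e4] at hY₂
  rw [e1, e3] at hY₁
  rw [e5, e6]
  generalize energy p q α x y = E at *
  generalize phiP p y = z at *
  generalize r ^ (2 * d) = T at *
  generalize r ^ (-2 * η) = S at *
  generalize r ^ (-η) = U at *
  generalize |y| ^ p = P at *
  generalize |x| ^ (q + 1) = X at *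
  have hK0 : 0 ≤ K := by rw [hK]; positivity
  clear_value K
  set D := |2 * d - N| with hD
  have hD0 : 0 ≤ D := abs_nonneg _
  have k1 : (2 * d - 2 * η) * S * E ≤ 2 * d * P + 2 * d * K * U * x ^ 2 := by
    have b1 : (2 * d - 2 * η) * S * E ≤ 2 * d * (S * E) := by
      have : 0 ≤ 2 * η * (S * E) := by positivity
      linarith
    have b2 : S * E ≤ S * (P + K * x ^ 2) := mul_le_mul_of_nonneg_left hE hS0.le
    have b3 : S * P ≤ P := mul_le_of_le_one_left hP0 hS1
    have b4 : S * (K * x ^ 2) ≤ U * (K * x ^ 2) := mul_le_mul_of_nonneg_right hSU (by positivity)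
    have b5 : S * E ≤ P + U * (K * x ^ 2) := by linarith
    have := mul_le_mul_of_nonneg_left b5 (by positivity : 0 ≤ 2 * d)
    linarith
  have k2 : (2 * d - N) * (x * z / r) ≤ D * (U * x ^ 2) + D * z ^ 2 / (U * r ^ 2) := by
    have b1 : (2 * d - N) * (x * z / r) ≤ D * |x * z / r| := by
      rw [hD, ← abs_mul]; exact le_abs_self _
    have b2 : |x * z / r| ≤ U * x ^ 2 + z ^ 2 / (U * r ^ 2) := by
      exact abs_mul_div_le x z hU hr0
    have := mul_le_mul_of_nonneg_left b2 hD0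
    have e : D * (U * x ^ 2 + z ^ 2 / (U * r ^ 2))
        = D * (U * x ^ 2) + D * z ^ 2 / (U * r ^ 2) := by ring
    linarith
  have k3 : D * z ^ 2 / (U * r ^ 2) ≤ 1 / 2 * (r ^ 2 * S) * y ^ 2 + C₂ * (U / T) := by
    rw [div_le_iff₀ (by positivity)]
    refine hY₂.trans (le_of_eq ?_)
    field_simp
  have k4 : S * (-(((N : ℝ) - 1) * P) - r ^ 2 * y ^ 2) ≤ -(r ^ 2 * S * y ^ 2) := by
    have : 0 ≤ S * (((N : ℝ) - 1) * P) := by positivity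
    linarith
  have k5 : 0 ≤ (α - d) * x ^ 2 := mul_nonneg (by linarith) (sq_nonneg x)
  have key : (2 * d - 2 * η) * S * E + S * (-(((N : ℝ) - 1) * P) - r ^ 2 * y ^ 2) + P - X
      - (α - d) * x ^ 2 + (2 * d - N) * (x * z / r) ≤
      U * ((2 * d * K + D) * x ^ 2 + (C₁ + C₂) / T) := by
    have : U * ((2 * d * K + D) * x ^ 2 + (C₁ + C₂) / T)
        = 2 * d * K * U * x ^ 2 + D * (U * x ^ 2) + C₁ * (U / T) + C₂ * (U / T) := by ring
    rw [this]
    linarith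
  refine (mul_le_mul_of_nonneg_left key (by positivity : 0 ≤ T / r)).trans (le_of_eq ?_)
  field_simp

end Lyapunov

/-- A Gronwall estimate with an integrable power weight. -/
lemma gronwall_rpow {F F' : ℝ → ℝ} {R η B : ℝ} (hR : 0 < R) (hη : 0 < η) (hB : 0 ≤ B)
    (hF : ContinuousOn F (Ici R)) (hF' : ∀ r, R < r → HasDerivAt F (F' r) r)
    (hF0 : ∀ r, R ≤ r → 0 ≤ F r) (hle : ∀ r, R < r → F' r ≤ B * r ^ (-1 - η) * F r)
    {r : ℝ} (hr : R ≤ r) : F r ≤ F R * Real.exp (B / η * R ^ (-η)) := by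
  have hanti : AntitoneOn (fun s => F s * Real.exp (B / η * s ^ (-η))) (Ici R) := by
    have hder (s : ℝ) (hs : R < s) : HasDerivAt (fun s => F s * Real.exp (B / η * s ^ (-η)))
        ((F' s - B * s ^ (-1 - η) * F s) * Real.exp (B / η * s ^ (-η))) s := by
      have h1 := (Real.hasDerivAt_rpow_const (x := s) (p := -η)
        (Or.inl (hR.trans hs).ne')).const_mul (B / η)
      refine ((hF' s hs).mul h1.exp).congr_deriv ?_
      rw [show -1 - η = -η - 1 by ring]
      field_simp
      ring
    refine antitoneOn_of_hasDerivWithinAt_nonpos (convex_Ici R) ?_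
      (fun s hs => (hder s (by simpa using hs)).hasDerivWithinAt) fun s hs => ?_
    · refine hF.mul (Real.continuous_exp.comp_continuousOn (continuousOn_const.mul ?_))
      exact continuousOn_id.rpow_const fun s hs => Or.inl (hR.trans_le hs).ne'
    · exact mul_nonpos_of_nonpos_of_nonneg (by linarith [hle s (by simpa using hs)])
        (Real.exp_pos _).le
  have hr0 : 0 < r := hR.trans_le hr
  calc F r ≤ F r * Real.exp (B / η * r ^ (-η)) :=
        le_mul_of_one_le_right (hF0 r hr) (Real.one_le_exp (by positivity))
    _ ≤ _ := hanti self_mem_Ici hr hr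

/-- Bounded solutions decay like `r ^ (-d)`, uniformly on bounded sets. -/
lemma exists_decay_bound {N : ℕ} (hN : 1 ≤ N) {p q α d M : ℝ} (hp : 1 < p) (hq : 1 < q)
    (hα : 0 < α) (hd : 0 ≤ d) (hdα : d ≤ α) (hdp : 2 < p ∨ p < 2 ∧ d < p / (2 - p))
    (hM : 0 ≤ M) :
    ∃ R₀ : ℝ, 1 ≤ R₀ ∧ ∀ R, R₀ ≤ R → ∃ C : ℝ, 0 ≤ C ∧ ∀ w v : ℝ → ℝ,
      SolvesPhaseSystem N p q α w v R → (∀ r, R ≤ r → |w r| ≤ M ∧ |v r| ≤ M) →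
        ∀ r, R ≤ r → |w r| ≤ C * r ^ (-d) := by
  obtain ⟨η, hη0, hη1, hη⟩ : ∃ η : ℝ, 0 < η ∧ η < 1 ∧
      (2 < p ∨ p < 2 ∧ η * (1 + p / (2 - p)) ≤ p / (2 - p) - d) := by
    rcases hdp with h | ⟨h, hd'⟩
    · exact ⟨1 / 2, by norm_num, by norm_num, Or.inl h⟩
    · have h2 : 0 < p / (2 - p) := div_pos (by linarith) (by linarith)
      refine ⟨(p / (2 - p) - d) / (1 + p / (2 - p)), div_pos (by linarith) (by linarith), ?_,
        Or.inr ⟨h, ?_⟩⟩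
      · rw [div_lt_one (by linarith)]
        linarith
      · rw [div_mul_cancel₀ _ (by linarith)]
  have hδ (h : p < 2) : (p - 1) / (2 - p) = (p / (2 - p) - 1) / 2 := by
    have : 2 - p ≠ 0 := by linarith
    field_simp
    ring
  have hδ1 (h : p < 2) : 1 < p / (2 - p) := by
    rw [lt_div_iff₀ (by linarith)]
    linarith
  obtain ⟨R₁, C₁, hC₁, hY₁⟩ := exists_mul_rpow_le (m := p) (n := 2) (b := 2 - 2 * η)
    (e := 2 * d + η) (A := 2 * d + 1) (ε := 1 / 2) (M := M) (by linarith) (by linarith)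
    (by linarith) (by norm_num) (by
      rcases hη with h | ⟨h, hη⟩
      · exact Or.inl h.le
      · refine Or.inr ⟨h, ?_⟩
        rw [mul_div_assoc]
        nlinarith [hδ1 h])
  obtain ⟨R₂, C₂, hC₂, hY₂⟩ := exists_mul_rpow_le (m := 2 * p - 2) (n := 2) (b := 4 - 3 * η)
    (e := 2 * d + 2 * η - 2) (A := |2 * d - N|) (ε := 1 / 2) (M := M) (by linarith)
    (by linarith) (abs_nonneg _) (by norm_num) (by
      rcases hη with h | ⟨h, hη⟩
      · exact Or.inl (by linarith)
      · refine Or.inr ⟨by linarith, ?_⟩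
        have e : (2 * p - 2) / (2 - (2 * p - 2)) = (p - 1) / (2 - p) := by
          rw [show 2 * p - 2 = 2 * (p - 1) by ring, show 2 - 2 * (p - 1) = 2 * (2 - p) by ring,
            mul_div_mul_left _ _ two_ne_zero]
        rw [mul_div_assoc, e, hδ h]
        nlinarith [hδ1 h])
  obtain ⟨R₃, C₃, hC₃, hY₃⟩ := exists_mul_rpow_le (m := 2 * p - 2) (n := p) (b := 2 - 2 * η)
    (e := 2 * d - 2) (A := 1) (ε := (p - 1) / p) (M := M) (by linarith)
    (by linarith) zero_le_one (div_pos (by linarith) (by linarith)) (by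
      rcases hη with h | ⟨h, hη⟩
      · exact Or.inl (by linarith)
      · refine Or.inr ⟨by linarith, ?_⟩
        have e : (2 * p - 2) / (p - (2 * p - 2)) = p / (2 - p) - 1 := by
          have : 2 - p ≠ 0 := by linarith
          rw [show p - (2 * p - 2) = 2 - p by ring]
          field_simp
          ring
        rw [mul_div_assoc, e]
        nlinarith [hδ1 h])
  refine ⟨max 1 (max R₁ (max R₂ R₃)), le_max_left _ _, fun R hR => ?_⟩
  simp only [max_le_iff] at hR
  obtain ⟨hR1, hRR₁, hRR₂, hRR₃⟩ := hR
  have hR0 : 0 < R := by linarith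
  have hq1 : 0 < q + 1 := by linarith
  have hp1 : 0 < p - 1 := by linarith
  have hp0 : 0 < p := by linarith
  set B := 2 * d * (α / 2 + M ^ (q - 1) / (q + 1)) + |2 * d - N| with hB
  have hB0 : 0 ≤ B := by positivity
  set D := C₁ + C₂ + C₃ with hD
  have hD0 : 0 ≤ D := by positivity
  set Λ := R ^ (2 * d - 2 * η) * ((p - 1) / p * M ^ p + α * M ^ 2 / 2 + M ^ (q + 1) / (q + 1))
    + R ^ (2 * d) * (M ^ 2 / 2) + R ^ (2 * d - 1) * (M * M ^ (p - 1)) + 2 * D with hΛ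
  set Q := 4 * (Λ * Real.exp ((4 * B + 1) / η * R ^ (-η))) with hQ
  refine ⟨√Q, Real.sqrt_nonneg _, fun w v h hb r hr => ?_⟩
  have hlow (s : ℝ) (hs : R ≤ s) : s ^ (2 * d) * w s ^ 2 ≤
      4 * (lyapunov p q α d η s (w s) (v s) + D) := by
    have := lyapunov_lower_bound (x := w s) hp hq hα (hR0.trans_le hs)
      (hY₃ s |v s| (hR1.trans hs) (hRR₃.trans hs) (abs_nonneg _) (hb s hs).2)
    linarith
  have hpos (s : ℝ) (hs : R ≤ s) : 0 ≤ lyapunov p q α d η s (w s) (v s) + D := by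
    have : 0 < s := hR0.trans_le hs
    have : 0 ≤ s ^ (2 * d) * w s ^ 2 := by positivity
    linarith [hlow s hs]
  have hgr : lyapunov p q α d η r (w r) (v r) + 2 * D ≤
      (lyapunov p q α d η R (w R) (v R) + 2 * D) * Real.exp ((4 * B + 1) / η * R ^ (-η)) := by
    refine gronwall_rpow (F := fun s => lyapunov p q α d η s (w s) (v s) + 2 * D) hR0 hη0
      (by positivity) ((h.continuousOn_lyapunov hp hq hR0).add continuousOn_const)
      (fun s hs => (h.hasDerivAt_lyapunov hp hq (hR0.trans hs) hs).add_const _)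
      (fun s hs => by linarith [hpos s hs]) (fun s hs => ?_) hr
    have hs0 : 0 < s := hR0.trans hs
    refine (lyapunov_deriv_bound hN hp hq hd hdα hη0 (hR1.trans hs.le) (hb s hs.le).1
      (hY₁ s |v s| (hR1.trans hs.le) (hRR₁.trans hs.le) (abs_nonneg _) (hb s hs.le).2)
      (hY₂ s |v s| (hR1.trans hs.le) (hRR₂.trans hs.le) (abs_nonneg _) (hb s hs.le).2)).trans ?_
    rw [← hB, mul_comm (4 * B + 1), mul_assoc]
    refine mul_le_mul_of_nonneg_left ?_ (by positivity)
    have k1 := mul_le_mul_of_nonneg_left (hlow s hs.le) hB0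
    have k2 := hpos s hs.le
    have k3 : 0 ≤ B * D := by positivity
    linarith
  have hR' : lyapunov p q α d η R (w R) (v R) + 2 * D ≤ Λ := by
    obtain ⟨hwM, hvM⟩ := hb R le_rfl
    have a1 : w R ^ 2 ≤ M ^ 2 := sq_le_sq' (abs_le.1 hwM).1 (abs_le.1 hwM).2
    have a2 : w R * phiP p (v R) ≤ M * M ^ (p - 1) := by
      refine (le_abs_self _).trans ?_
      rw [abs_mul, abs_phiP hp]
      gcongr
    rw [hΛ]
    unfold lyapunov energy
    gcongr
  have hfin : (|w r| * r ^ d) ^ 2 ≤ Q := by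
    have hr0 : 0 < r := hR0.trans_le hr
    have e : (|w r| * r ^ d) ^ 2 = r ^ (2 * d) * w r ^ 2 := by
      rw [mul_pow, sq_abs, ← Real.rpow_natCast (r ^ d), ← Real.rpow_mul hr0.le, mul_comm]
      congr 2
      push_cast
      ring
    have := mul_le_mul_of_nonneg_right hR' (Real.exp_pos ((4 * B + 1) / η * R ^ (-η))).le
    rw [e, hQ]
    linarith [hlow r hr]
  rw [Real.rpow_neg (hR0.trans_le hr).le, ← div_eq_mul_inv,
    le_div_iff₀ (Real.rpow_pos_of_pos (hR0.trans_le hr) d)]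
  exact Real.le_sqrt_of_sq_le hfin

lemma SolvesPhaseSystem.mono {N : ℕ} {p q α : ℝ} {w v : ℝ → ℝ} {r₀ r₁ : ℝ}
    (h : SolvesPhaseSystem N p q α w v r₀) (hr : r₀ ≤ r₁) : SolvesPhaseSystem N p q α w v r₁ :=
  ⟨h.1.mono (Ici_subset_Ici.2 hr), h.2.1.mono (Ici_subset_Ici.2 hr),
    fun r h' => h.2.2 r (hr.trans_lt h')⟩

lemma solvesPhaseSystem_of_contDiffOn {N : ℕ} {p q α : ℝ} {w : ℝ → ℝ} {r₀ : ℝ}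
    (hw : ContDiffOn ℝ 1 w (Ici r₀))
    (hy : ContDiffOn ℝ 1 (fun r => phiP p (derivWithin w (Ici r₀) r)) (Ici r₀))
    (heq : ∀ r, r₀ < r → derivWithin (fun s => phiP p (derivWithin w (Ici r₀) s)) (Ici r₀) r
      + ((N : ℝ) - 1) / r * phiP p (derivWithin w (Ici r₀) r)
      + r * derivWithin w (Ici r₀) r + α * w r + |w r| ^ (q - 1) * w r = 0) :
    SolvesPhaseSystem N p q α w (derivWithin w (Ici r₀)) r₀ := by
  refine ⟨hw.continuousOn, hy.continuousOn, fun r hr => ?_⟩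
  have hd {f : ℝ → ℝ} (hf : ContDiffOn ℝ 1 f (Ici r₀)) :
      HasDerivAt f (derivWithin f (Ici r₀) r) r :=
    ((hf.differentiableOn one_ne_zero) r hr.le).hasDerivWithinAt.hasDerivAt (Ici_mem_nhds hr)
  exact ⟨hd hw, (hd hy).congr_deriv (by linarith [heq r hr])⟩

lemma IsSolutionOn.solvesPhaseSystem {N : ℕ} {p q α : ℝ} {w : ℝ → ℝ} {r₀ : ℝ}
    (h : IsSolutionOn N p q α w (Ici r₀)) :
    SolvesPhaseSystem N p q α w (derivWithin w (Ici r₀)) r₀ :=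
  solvesPhaseSystem_of_contDiffOn h.1 h.2.1 fun r hr => h.2.2 r hr.le

lemma IsGlobalSolution.solvesPhaseSystem {N : ℕ} {p q α a : ℝ} {w : ℝ → ℝ}
    (h : IsGlobalSolution N p q α a w) :
    SolvesPhaseSystem N p q α w (derivWithin w (Ici 0)) 0 :=
  solvesPhaseSystem_of_contDiffOn h.1 h.2.1 h.2.2.1

/-- A family of real upper bounds that is locally uniform has a continuous selection. -/
lemma exists_continuous_upper_bound {P : ℝ → ℝ → Prop} (hmono : ∀ a C C', C ≤ C' → P a C → P a C')
    (hloc : ∀ A : ℝ, ∃ C, ∀ a, |a| ≤ A → P a C) : ∃ C : ℝ → ℝ, Continuous C ∧ ∀ a, P a (C a) := by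
  obtain ⟨g, hg⟩ := exists_continuous_forall_mem_convex_of_local_const
    (t := fun a : ℝ => {C : ℝ | P a C})
    (fun a => (show IsUpperSet {C : ℝ | P a C} from
      fun C C' h => hmono a C C' h).ordConnected.convex)
    fun a => by
      obtain ⟨C, hC⟩ := hloc (|a| + 1)
      refine ⟨C, ?_⟩
      filter_upwards [continuous_abs.continuousAt.eventually_lt continuousAt_const
        (lt_add_one |a|)] with b hb using hC b hb.le
  exact ⟨g, g.continuous, hg⟩

/-- (i) For any `γ ≥ 0` if `p > 2`, `γ ∈ [0,δ)` if `p < 2`, every solution of (E) on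
`[r₀,∞)` satisfies `w(r) = O(r^{-γ}) + O(r^{-α})` as `r → ∞`. (ii) The global
solution satisfies `|w(r,a)| ≤ C_γ(a)((1+r)^{-γ} + (1+r)^{-α})` with `C_γ`
continuous on `ℝ`. -/
theorem stmt7 (N : ℕ) (hN : 1 ≤ N) (p q α : ℝ) (hp : 1 < p) (hq : 1 < q) (hα : 0 < α)
    (γ : ℝ) (hγ : (2 < p ∧ 0 ≤ γ) ∨ (p < 2 ∧ 0 ≤ γ ∧ γ < p / (2 - p))) :
    (∀ r₀ : ℝ, 0 < r₀ → ∀ w : ℝ → ℝ, IsSolutionOn N p q α w (Ici r₀) →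
      w =O[atTop] fun r : ℝ => r ^ (-γ) + r ^ (-α)) ∧
    (∃ C : ℝ → ℝ, Continuous C ∧
      ∀ a : ℝ, ∀ w : ℝ → ℝ, IsGlobalSolution N p q α a w →
        ∀ r ∈ Ici (0 : ℝ), |w r| ≤ C a * ((1 + r) ^ (-γ) + (1 + r) ^ (-α))) := by
  have hdp : 2 < p ∨ p < 2 ∧ min γ α < p / (2 - p) := by
    rcases hγ with h | ⟨h, _, h'⟩
    · exact Or.inl h.1
    · exact Or.inr ⟨h, (min_le_left _ _).trans_lt h'⟩
  have hγ0 : 0 ≤ γ := by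
    rcases hγ with h | h
    · exact h.2
    · exact h.2.1
  have hd : 0 ≤ min γ α := le_min hγ0 hα.le
  have hmin (s : ℝ) (hs : 0 < s) : s ^ (-min γ α) ≤ s ^ (-γ) + s ^ (-α) := by
    have h1 : 0 < s ^ (-γ) := by positivity
    have h2 : 0 < s ^ (-α) := by positivity
    rcases min_choice γ α with h | h <;> rw [h] <;> linarith
  refine ⟨fun r₀ hr₀ w hw => ?_, ?_⟩
  · have hs := hw.solvesPhaseSystem
    obtain ⟨M, hM, hbound⟩ := exists_abs_le_of_energy_le hp hq hα
      (energy p q α (w r₀) (derivWithin w (Ici r₀) r₀))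
    obtain ⟨R₀, hR₀, hdecay⟩ := exists_decay_bound hN hp hq hα hd (min_le_right _ _) hdp hM
    obtain ⟨C, hC, hCw⟩ := hdecay (max R₀ r₀) (le_max_left _ _)
    have hle := hCw w _ (hs.mono (le_max_right _ _)) fun r hr => hbound _ _
      (hs.antitoneOn_energy hN hp hq hr₀.le self_mem_Ici (le_of_max_le_right hr)
        (le_of_max_le_right hr))
    refine IsBigO.of_bound C ?_
    filter_upwards [eventually_ge_atTop (max R₀ r₀)] with r hr
    have hr0 : 0 < r := hr₀.trans_le (le_of_max_le_right hr)
    rw [Real.norm_eq_abs, Real.norm_eq_abs]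
    calc |w r| ≤ C * r ^ (-min γ α) := hle r hr
      _ ≤ C * |r ^ (-γ) + r ^ (-α)| := by
        gcongr
        exact (hmin r hr0).trans (le_abs_self _)
  · refine exists_continuous_upper_bound
      (P := fun a C => ∀ w : ℝ → ℝ, IsGlobalSolution N p q α a w →
        ∀ r ∈ Ici (0 : ℝ), |w r| ≤ C * ((1 + r) ^ (-γ) + (1 + r) ^ (-α)))
      (fun a C C' hC h w hw r hr => (h w hw r hr).trans ?_) fun A => ?_
    · have hr : 0 < 1 + r := by linarith [mem_Ici.1 hr]
      gcongr
    obtain ⟨M, hM, hbound⟩ := exists_abs_le_of_energy_le hp hq hα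
      (energy p q α A 0)
    obtain ⟨R, hR, hdecay⟩ := exists_decay_bound hN hp hq hα hd (min_le_right _ _) hdp hM
    obtain ⟨C, hC, hCw⟩ := hdecay R le_rfl
    refine ⟨M * (1 + R) ^ min γ α + C * 2 ^ min γ α, fun a ha w hw r hr => ?_⟩
    have hr : 0 ≤ r := hr
    have hs := hw.solvesPhaseSystem
    have hwM (s : ℝ) (hs0 : 0 ≤ s) : |w s| ≤ M ∧ |derivWithin w (Ici 0) s| ≤ M := by
      refine hbound _ _
        ((hs.antitoneOn_energy hN hp hq le_rfl self_mem_Ici (mem_Ici.2 hs0) hs0).trans ?_)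
      have hA : |a| ≤ |A| := ha.trans (le_abs_self A)
      have hA2 : a ^ 2 ≤ A ^ 2 := sq_le_sq.2 hA
      have hq1 : 0 < q + 1 := by linarith
      simp only [hw.2.2.2.1, hw.2.2.2.2]
      unfold energy
      gcongr
    refine le_trans ?_ (mul_le_mul_of_nonneg_left (hmin (1 + r) (by linarith)) (by positivity))
    have hinv {s : ℝ} (hs : 0 < s) : s ^ (-min γ α) = (s ^ min γ α)⁻¹ := Real.rpow_neg hs.le _
    have h1r : 0 < 1 + r := by linarith
    have hR0 : 0 < R := by linarith
    rw [hinv h1r, ← div_eq_mul_inv, le_div_iff₀ (by positivity)]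
    rcases le_total r R with hrR | hrR
    · have : |w r| * (1 + r) ^ min γ α ≤ M * (1 + R) ^ min γ α := by
        gcongr
        exact (hwM r hr).1
      have : 0 ≤ C * (2 : ℝ) ^ min γ α := by positivity
      linarith
    · have hle := hCw w _ (hs.mono hR0.le) (fun s hs => hwM s (hR0.le.trans hs)) r hrR
      have hr0 : 0 < r := by linarith
      rw [hinv hr0, ← div_eq_mul_inv, le_div_iff₀ (by positivity)] at hle
      have h2 : (1 + r) ^ min γ α ≤ 2 ^ min γ α * r ^ min γ α := by
        rw [← Real.mul_rpow (by norm_num) hr0.le]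
        exact Real.rpow_le_rpow h1r.le (by linarith) hd
      have h3 : |w r| * (1 + r) ^ min γ α ≤ C * 2 ^ min γ α := by
        calc |w r| * (1 + r) ^ min γ α ≤ |w r| * (2 ^ min γ α * r ^ min γ α) := by gcongr
          _ = |w r| * r ^ min γ α * 2 ^ min γ α := by ring
          _ ≤ _ := by gcongr
      have : 0 ≤ M * (1 + R) ^ min γ α := by positivity
      linarith
end

section
/- Assume p < 2 and α < δ. Let w be a solution of equation (E) on [r₀,∞) such that lim_{r→∞} r^α w(r) = 0 and such that w has only finitely many zeros. Then: (i) if p₁ < p, lim_{r→∞} r^δ w(r) = ℓ or lim_{r→∞} r^δ w(r) = -ℓ; (ii) if p < p₁, lim_{r→∞} r^η w(r) = c for some c ∈ ℝ with c ≠ 0; (iii) if p = p₁, lim_{r→∞} r^N (ln r)^{(N+1)/2} w(r) = ϱ or = -ϱ, where ϱ = (1/N) (N(N-1)/(2(N-α)))^{(N+1)/2}. -/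
open Set Filter Topology Asymptotics

/-- A function with nonnegative derivative on a half-line is monotone there. -/
lemma monotoneOn_Ici_of_hasDerivAt {f f' : ℝ → ℝ} {s : ℝ}
    (hf : ∀ t ≥ s, HasDerivAt f (f' t) t) (h : ∀ t ≥ s, 0 ≤ f' t) : MonotoneOn f (Ici s) := by
  refine monotoneOn_of_hasDerivWithinAt_nonneg (f' := f') (convex_Ici s)
    (fun t ht => (hf t ht).continuousAt.continuousWithinAt) ?_ ?_
  · intro t ht
    exact (hf t (interior_subset ht)).hasDerivWithinAt
  · intro t ht
    exact h t (interior_subset ht)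

lemma antitoneOn_Ici_of_hasDerivAt {f f' : ℝ → ℝ} {s : ℝ}
    (hf : ∀ t ≥ s, HasDerivAt f (f' t) t) (h : ∀ t ≥ s, f' t ≤ 0) : AntitoneOn f (Ici s) := by
  refine antitoneOn_of_hasDerivWithinAt_nonpos (f' := f') (convex_Ici s)
    (fun t ht => (hf t ht).continuousAt.continuousWithinAt) ?_ ?_
  · intro t ht
    exact (hf t (interior_subset ht)).hasDerivWithinAt
  · intro t ht
    exact h t (interior_subset ht)

lemma le_of_le_hasDerivAt {f f' : ℝ → ℝ} {s c : ℝ}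
    (hf : ∀ t ≥ s, HasDerivAt f (f' t) t) (h : ∀ t ≥ s, c ≤ f' t) :
    ∀ t ≥ s, f s + c * (t - s) ≤ f t := by
  intro t ht
  have := monotoneOn_Ici_of_hasDerivAt (f := fun t => f t - c * t) (f' := fun t => f' t - c * 1)
    (fun t ht => (hf t ht).sub ((hasDerivAt_id t).const_mul c))
    (fun t ht => by linarith [h t ht]) self_mem_Ici ht ht
  simp only at this
  linarith

lemma tendsto_atTop_of_le_hasDerivAt {f f' : ℝ → ℝ} {s c : ℝ} (hc : 0 < c)
    (hf : ∀ t ≥ s, HasDerivAt f (f' t) t) (h : ∀ t ≥ s, c ≤ f' t) :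
    Tendsto f atTop atTop := by
  have h1 : Tendsto (fun t => f s + c * (t - s)) atTop atTop :=
    tendsto_atTop_add_const_left _ _
      ((tendsto_atTop_add_const_right _ (-s) tendsto_id).const_mul_atTop hc)
  refine tendsto_atTop_mono' _ ?_ h1
  filter_upwards [eventually_ge_atTop s] with t ht using le_of_le_hasDerivAt hf h t ht

lemma tendsto_atBot_of_hasDerivAt_le {f f' : ℝ → ℝ} {s c : ℝ} (hc : 0 < c)
    (hf : ∀ t ≥ s, HasDerivAt f (f' t) t) (h : ∀ t ≥ s, f' t ≤ -c) :
    Tendsto f atTop atBot := by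
  have := tendsto_atTop_of_le_hasDerivAt hc (f := fun t => -f t) (f' := fun t => -f' t)
    (fun t ht => (hf t ht).neg) (fun t ht => by linarith [h t ht])
  simpa [Function.comp_def] using tendsto_neg_atTop_atBot.comp this

/-- A function whose derivative is positive at each first return to zero stays nonnegative. -/
lemma nonneg_of_hasDerivAt_pos_of_eq_zero {f f' : ℝ → ℝ} {s : ℝ}
    (hf : ∀ t ≥ s, HasDerivAt f (f' t) t) (hs : 0 ≤ f s)
    (h : ∀ t ≥ s, (∀ τ ∈ Icc s t, 0 ≤ f τ) → f t = 0 → 0 < f' t) :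
    ∀ t ≥ s, 0 ≤ f t := by
  by_contra! hcon
  obtain ⟨b, hb, hfb⟩ := hcon
  set A : Set ℝ := {t | t ∈ Icc s b ∧ ∀ τ ∈ Icc s t, 0 ≤ f τ} with hA
  have hsA : s ∈ A := ⟨⟨le_rfl, hb⟩, fun τ hτ => by
    rwa [le_antisymm hτ.2 hτ.1]⟩
  have hbdd : BddAbove A := ⟨b, fun t ht => ht.1.2⟩
  set c := sSup A with hc
  have hsc : s ≤ c := le_csSup hbdd hsA
  have hcb : c ≤ b := csSup_le ⟨s, hsA⟩ fun t ht => ht.1.2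
  have hlt : ∀ τ, s ≤ τ → τ < c → 0 ≤ f τ := by
    intro τ h1 h2
    obtain ⟨t, ht, hτt⟩ := exists_lt_of_lt_csSup ⟨s, hsA⟩ h2
    exact ht.2 τ ⟨h1, hτt.le⟩
  have hfc : 0 ≤ f c := by
    rcases hsc.eq_or_lt with e | e
    · rwa [← e]
    · refine ge_of_tendsto ((hf c hsc).continuousAt.tendsto.mono_left
        (nhdsWithin_le_nhds (s := Iio c))) ?_
      filter_upwards [Ioo_mem_nhdsLT e] with τ hτ using hlt τ hτ.1.le hτ.2
  have hall : ∀ τ ∈ Icc s c, 0 ≤ f τ := by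
    intro τ hτ
    rcases hτ.2.eq_or_lt with e | e
    · rwa [e]
    · exact hlt τ hτ.1 e
  have hcb' : c < b := lt_of_le_of_ne hcb fun e => by rw [e] at hfc; linarith
  have hev : ∀ᶠ τ in 𝓝[>] c, 0 ≤ f τ := by
    rcases hfc.eq_or_lt with e | e
    · have hd := h c hsc hall e.symm
      have := (hasDerivWithinAt_iff_tendsto_slope' (s := Ioi c) (by simp)).1
        (hf c hsc).hasDerivWithinAt
      filter_upwards [this.eventually (eventually_gt_nhds hd), self_mem_nhdsWithin] with τ h1 h2
      rw [slope_def_field, ← e, sub_zero] at h1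
      have h3 : 0 < τ - c := sub_pos.2 h2
      exact ((div_pos_iff_of_pos_right h3).1 h1).le
    · filter_upwards [nhdsWithin_le_nhds ((hf c hsc).continuousAt.eventually
        (eventually_gt_nhds e))] with τ hτ using hτ.le
  obtain ⟨d, hd, hd'⟩ := (mem_nhdsGT_iff_exists_Ioo_subset' hcb').1 hev
  set e := min ((c + d) / 2) b with he
  have hce : c < e := lt_min (by simp only [mem_Ioi] at hd; linarith) hcb'
  have hed : e < d := (min_le_left _ _).trans_lt (by simp only [mem_Ioi] at hd; linarith)
  have : e ∈ A := by
    refine ⟨⟨hsc.trans hce.le, min_le_right _ _⟩, fun τ hτ => ?_⟩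
    rcases le_or_gt τ c with h1 | h1
    · exact hall τ ⟨hτ.1, h1⟩
    · exact hd' ⟨h1, hτ.2.trans_lt hed⟩
  exact absurd (le_csSup hbdd this) (not_le.2 hce)

/-- A positive function whose logarithmic derivative is at least `-C * exp (-k t)` is bounded
below by a positive constant. -/
lemma exists_pos_le_of_logDeriv_ge {m m' : ℝ → ℝ} {s C k : ℝ} (hC : 0 ≤ C) (hk : 0 < k)
    (hm : ∀ t ≥ s, HasDerivAt m (m' t) t) (hpos : ∀ t ≥ s, 0 < m t)
    (h : ∀ t ≥ s, -(C * Real.exp (-k * t)) * m t ≤ m' t) :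
    ∃ c > 0, ∀ t ≥ s, c ≤ m t := by
  set E : ℝ → ℝ := fun t => Real.exp (-(C / k) * Real.exp (-k * t))
  have hE : ∀ t, HasDerivAt E (E t * (C * Real.exp (-k * t))) t := by
    intro t
    have h1 : HasDerivAt (fun t : ℝ => -k * t) (-k) t := by
      simpa using (hasDerivAt_id t).const_mul (-k)
    convert (h1.exp.const_mul (-(C / k))).exp using 1
    simp only [E]
    field_simp
  have hmono := monotoneOn_Ici_of_hasDerivAt (f := fun t => m t * E t)
    (fun t ht => (hm t ht).mul (hE t)) (fun t ht => by
      have : 0 < E t := Real.exp_pos _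
      nlinarith [h t ht])
  refine ⟨m s * E s, mul_pos (hpos s le_rfl) (Real.exp_pos _), fun t ht => ?_⟩
  refine (hmono self_mem_Ici ht ht).trans ?_
  have : E t ≤ 1 := Real.exp_le_one_iff.2 (by
    have : 0 ≤ C / k := by positivity
    nlinarith [Real.exp_pos (-k * t)])
  nlinarith [hpos t ht]

/-- One-sided comparison for the unstable linear equation `f' = k f - g`. -/
lemma le_div_of_unstable {f g : ℝ → ℝ} {s k c : ℝ} (hk : 0 < k)
    (hf : ∀ t ≥ s, HasDerivAt f (k * f t - g t) t)
    (h0 : Tendsto (fun t => Real.exp (-k * t) * f t) atTop (𝓝 0)) (hg : ∀ t ≥ s, g t ≤ c) :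
    ∀ t ≥ s, f t ≤ c / k := by
  have hE : ∀ t, HasDerivAt (fun t : ℝ => Real.exp (-k * t)) (Real.exp (-k * t) * (-k)) t := by
    intro t
    have h1 : HasDerivAt (fun t : ℝ => -k * t) (-k) t := by
      simpa using (hasDerivAt_id t).const_mul (-k)
    exact h1.exp
  have hmono := monotoneOn_Ici_of_hasDerivAt
    (f := fun t => Real.exp (-k * t) * (f t - c / k))
    (fun t ht => (hE t).mul ((hf t ht).sub_const (c / k))) (fun t ht => by
      have h1 : k * (c / k) = c := by field_simp
      have := mul_nonneg (Real.exp_pos (-k * t)).le (sub_nonneg.2 (hg t ht))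
      linear_combination this - Real.exp (-k * t) * h1)
  have hE0 : Tendsto (fun t : ℝ => Real.exp (-k * t)) atTop (𝓝 0) :=
    Real.tendsto_exp_atBot.comp (tendsto_id.const_mul_atTop_of_neg (neg_lt_zero.2 hk))
  have hlim : Tendsto (fun t => Real.exp (-k * t) * (f t - c / k)) atTop (𝓝 0) := by
    have := h0.sub (hE0.mul_const (c / k))
    simp only [zero_mul, sub_zero] at this
    refine this.congr fun t => by ring
  intro t ht
  have h2 : Real.exp (-k * t) * (f t - c / k) ≤ 0 := by
    refine ge_of_tendsto hlim ?_
    filter_upwards [eventually_ge_atTop t] with τ hτ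
    exact hmono ht (le_trans ht hτ) hτ
  have := nonpos_of_mul_nonpos_right h2 (Real.exp_pos _)
  linarith

lemma div_le_of_unstable {f g : ℝ → ℝ} {s k c : ℝ} (hk : 0 < k)
    (hf : ∀ t ≥ s, HasDerivAt f (k * f t - g t) t)
    (h0 : Tendsto (fun t => Real.exp (-k * t) * f t) atTop (𝓝 0)) (hg : ∀ t ≥ s, c ≤ g t) :
    ∀ t ≥ s, c / k ≤ f t := by
  intro t ht
  have := le_div_of_unstable (f := fun t => -f t) (g := fun t => -g t) (c := -c) hk
    (fun t ht => (hf t ht).neg.congr_deriv (by ring))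
    (by simpa using h0.neg) (fun t ht => by linarith [hg t ht]) t ht
  rw [neg_div] at this
  linarith

/-- A solution of `f' = k f - g` that does not pick up the exponential mode converges
whenever `g` does. -/
lemma tendsto_div_of_unstable {f g : ℝ → ℝ} {s k b : ℝ} (hk : 0 < k)
    (hf : ∀ t ≥ s, HasDerivAt f (k * f t - g t) t)
    (h0 : Tendsto (fun t => Real.exp (-k * t) * f t) atTop (𝓝 0)) (hg : Tendsto g atTop (𝓝 b)) :
    Tendsto f atTop (𝓝 (b / k)) := by
  rw [tendsto_order]
  constructor
  · intro a ha
    rw [lt_div_iff₀ hk] at ha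
    obtain ⟨c, hc1, hc2⟩ := exists_between ha
    obtain ⟨s', hs'⟩ := eventually_atTop.1 (hg.eventually (eventually_gt_nhds hc2))
    filter_upwards [eventually_ge_atTop (max s s')] with t ht
    refine lt_of_lt_of_le ((lt_div_iff₀ hk).2 hc1) (div_le_of_unstable (s := max s s') hk
      (fun t ht => hf t (le_trans (le_max_left _ _) ht)) h0
      (fun t ht => (hs' t (le_trans (le_max_right _ _) ht)).le) t ht)
  · intro a (ha : b / k < a)
    rw [div_lt_iff₀ hk] at ha
    obtain ⟨c, hc1, hc2⟩ := exists_between ha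
    obtain ⟨s', hs'⟩ := eventually_atTop.1 (hg.eventually (eventually_lt_nhds hc1))
    filter_upwards [eventually_ge_atTop (max s s')] with t ht
    refine lt_of_le_of_lt (le_div_of_unstable (s := max s s') hk
      (fun t ht => hf t (le_trans (le_max_left _ _) ht)) h0
      (fun t ht => (hs' t (le_trans (le_max_right _ _) ht)).le) t ht) ((div_lt_iff₀ hk).2 hc2)

lemma eventually_lt_div_of_hasDerivAt {f f' : ℝ → ℝ} {s κ : ℝ}
    (hf : ∀ t ≥ s, HasDerivAt f (f' t) t) (h : Tendsto f' atTop (𝓝 κ)) {a : ℝ} (ha : a < κ) :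
    ∀ᶠ t in atTop, a < f t / t := by
  obtain ⟨c, hc1, hc2⟩ := exists_between ha
  obtain ⟨s', hs'⟩ := eventually_atTop.1 (h.eventually (eventually_gt_nhds hc2))
  set S := max s s'
  have h1 := le_of_le_hasDerivAt (s := S) (fun t ht => hf t (le_trans (le_max_left _ _) ht))
    (fun t ht => (hs' t (le_trans (le_max_right _ _) ht)).le)
  filter_upwards [eventually_ge_atTop S, eventually_gt_atTop 0,
    eventually_gt_atTop ((c * S - f S) / (c - a))] with t ht ht0 ht1
  rw [lt_div_iff₀ ht0]
  rw [div_lt_iff₀ (by linarith)] at ht1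
  linarith [h1 t ht]

/-- If the derivative of `f` tends to `κ`, then `f t / t` tends to `κ`. -/
lemma tendsto_div_self_of_hasDerivAt {f f' : ℝ → ℝ} {s κ : ℝ}
    (hf : ∀ t ≥ s, HasDerivAt f (f' t) t) (h : Tendsto f' atTop (𝓝 κ)) :
    Tendsto (fun t => f t / t) atTop (𝓝 κ) := by
  rw [tendsto_order]
  refine ⟨fun a ha => eventually_lt_div_of_hasDerivAt hf h ha, fun a ha => ?_⟩
  filter_upwards [eventually_lt_div_of_hasDerivAt (f := fun t => -f t)
    (fun t ht => (hf t ht).neg) h.neg (neg_lt_neg ha)] with t ht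
  rw [neg_div] at ht
  linarith

/-- A function antitone on a half-line and bounded below there converges. -/
lemma exists_tendsto_of_antitoneOn_Ici {f : ℝ → ℝ} {s c : ℝ} (hf : AntitoneOn f (Ici s))
    (hc : ∀ t ≥ s, c ≤ f t) : ∃ l, c ≤ l ∧ Tendsto f atTop (𝓝 l) := by
  have hanti : Antitone fun t => f (max s t) := fun a b hab =>
    hf (le_max_left s a) (le_max_left s b) (max_le_max le_rfl hab)
  have hb : BddBelow (range fun t => f (max s t)) :=
    ⟨c, by rintro _ ⟨t, rfl⟩; exact hc _ (le_max_left _ _)⟩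
  have h := tendsto_atTop_ciInf hanti hb
  have h' : Tendsto f atTop (𝓝 (⨅ t, f (max s t))) := by
    refine h.congr' ?_
    filter_upwards [eventually_ge_atTop s] with t ht
    rw [max_eq_right ht]
  refine ⟨_, ge_of_tendsto h' ?_, h'⟩
  filter_upwards [eventually_ge_atTop s] with t ht using hc t ht

lemma tendsto_exp_neg_mul_atTop {k : ℝ} (hk : 0 < k) :
    Tendsto (fun t : ℝ => Real.exp (-k * t)) atTop (𝓝 0) :=
  Real.tendsto_exp_atBot.comp (tendsto_id.const_mul_atTop_of_neg (neg_lt_zero.2 hk))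

/-- The equation in logarithmic time: for a positive decreasing solution `w` one puts
`V t = r ^ δ * w r`, `U t = -r ^ (δ + 1) * w' r` and `ε t = w r ^ (q - 1)` with `r = exp t`. -/
structure LogFlow (n p α δ k T : ℝ) (V U ε : ℝ → ℝ) : Prop where
  one_lt_p : 1 < p
  p_lt_two : p < 2
  α_pos : 0 < α
  α_lt_δ : α < δ
  k_pos : 0 < k
  V_pos : ∀ t ≥ T, 0 < V t
  U_pos : ∀ t ≥ T, 0 < U t
  ε_nonneg : ∀ t ≥ T, 0 ≤ ε t
  ε_le : ∀ t ≥ T, ε t ≤ Real.exp (-k * t)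
  hasDerivAt_V : ∀ t ≥ T, HasDerivAt V (δ * V t - U t) t
  hasDerivAt_P : ∀ t ≥ T, HasDerivAt (fun t => U t ^ (p - 1))
    ((δ - n) * U t ^ (p - 1) - U t + (α + ε t) * V t) t
  decay : Tendsto (fun t => Real.exp (-(δ - α) * t) * V t) atTop (𝓝 0)

namespace LogFlow

variable {n p α δ k T : ℝ} {V U ε : ℝ → ℝ}

lemma δ_pos (h : LogFlow n p α δ k T V U ε) : 0 < δ := h.α_pos.trans h.α_lt_δ

lemma hasDerivAt_M (h : LogFlow n p α δ k T V U ε) : ∀ t ≥ T,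
    HasDerivAt (fun t => V t - U t ^ (p - 1))
      ((δ - α - ε t) * V t - (δ - n) * U t ^ (p - 1)) t := fun t ht =>
  ((h.hasDerivAt_V t ht).sub (h.hasDerivAt_P t ht)).congr_deriv (by ring)

lemma hasDerivAt_D (h : LogFlow n p α δ k T V U ε) : ∀ t ≥ T,
    HasDerivAt (fun t => (δ * V t) ^ (p - 1) - U t ^ (p - 1))
      (δ * (δ * V t - U t) * (p - 1) * (δ * V t) ^ (p - 1 - 1)
        - ((δ - n) * U t ^ (p - 1) - U t + (α + ε t) * V t)) t := fun t ht =>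
  (((h.hasDerivAt_V t ht).const_mul δ).rpow_const
    (Or.inl (mul_pos h.δ_pos (h.V_pos t ht)).ne')).sub (h.hasDerivAt_P t ht)

lemma le_iff_rpow (h : LogFlow n p α δ k T V U ε) {t : ℝ} (ht : T ≤ t) :
    U t ≤ δ * V t ↔ U t ^ (p - 1) ≤ (δ * V t) ^ (p - 1) :=
  (Real.rpow_le_rpow_iff (h.U_pos t ht).le (mul_pos h.δ_pos (h.V_pos t ht)).le
    (by linarith [h.one_lt_p])).symm

lemma ge_iff_rpow (h : LogFlow n p α δ k T V U ε) {t : ℝ} (ht : T ≤ t) :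
    δ * V t ≤ U t ↔ (δ * V t) ^ (p - 1) ≤ U t ^ (p - 1) :=
  (Real.rpow_le_rpow_iff (mul_pos h.δ_pos (h.V_pos t ht)).le (h.U_pos t ht).le
    (by linarith [h.one_lt_p])).symm

lemma eventually_ε_le (h : LogFlow n p α δ k T V U ε) {c : ℝ} (hc : 0 < c) :
    ∀ᶠ t in atTop, ε t ≤ c := by
  filter_upwards [(tendsto_exp_neg_mul_atTop h.k_pos).eventually (eventually_le_nhds hc),
    eventually_ge_atTop T] with t h1 h2 using (h.ε_le t h2).trans h1

lemma tendsto_ε (h : LogFlow n p α δ k T V U ε) : Tendsto ε atTop (𝓝 0) := by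
  refine squeeze_zero' ?_ ?_ (tendsto_exp_neg_mul_atTop h.k_pos)
  · filter_upwards [eventually_ge_atTop T] with t ht using h.ε_nonneg t ht
  · filter_upwards [eventually_ge_atTop T] with t ht using h.ε_le t ht

/-- `V` cannot increase forever above a level where `(δ - n) (δ x)^(p-1) < (δ - α) x`: it would
grow so fast that `r ^ α * w r` would stay away from zero. -/
lemma not_increasing_above (h : LogFlow n p α δ k T V U ε) {L c s : ℝ} (hL : 0 < L) (hc : 0 < c)
    (hcδ : c ≤ δ - α) (hLc : ∀ x ≥ L, (δ - n) * (δ * x) ^ (p - 1) ≤ (δ - α - c) * x)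
    (hs : T ≤ s) (hε : ∀ t ≥ s, ε t ≤ c / 2) (hV : ∀ t ≥ s, L ≤ V t)
    (hU : ∀ t ≥ s, U t ≤ δ * V t) : False := by
  have hp := h.one_lt_p
  have hp2 := h.p_lt_two
  have hδ := h.δ_pos
  have hVpos : ∀ t ≥ s, 0 < V t := fun t ht => h.V_pos t (hs.trans ht)
  have hPpos : ∀ t ≥ s, 0 < U t ^ (p - 1) := fun t ht =>
    Real.rpow_pos_of_pos (h.U_pos t (hs.trans ht)) _
  have hP : ∀ t ≥ s, U t ^ (p - 1) ≤ (δ * V t) ^ (p - 1) := fun t ht =>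
    (h.le_iff_rpow (hs.trans ht)).1 (hU t ht)
  set M : ℝ → ℝ := fun t => V t - U t ^ (p - 1) with hMdef
  have hM : ∀ t ≥ s, HasDerivAt M ((δ - α - ε t) * V t - (δ - n) * U t ^ (p - 1)) t :=
    fun t ht => h.hasDerivAt_M t (hs.trans ht)
  have hM' : ∀ t ≥ s, c / 2 * V t ≤ (δ - α - ε t) * V t - (δ - n) * U t ^ (p - 1) := by
    intro t ht
    have h1 : (δ - n) * U t ^ (p - 1) ≤ (δ - α - c) * V t := by
      rcases le_total n δ with h2 | h2
      · exact (mul_le_mul_of_nonneg_left (hP t ht) (by linarith)).trans (hLc _ (hV t ht))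
      · nlinarith [hPpos t ht, mul_nonneg (sub_nonneg.2 hcδ) (hVpos t ht).le,
          mul_nonneg (sub_nonneg.2 h2) (hPpos t ht).le]
    nlinarith [mul_nonneg (sub_nonneg.2 (hε t ht)) (hVpos t ht).le]
  have hMtop : Tendsto M atTop atTop := by
    refine tendsto_atTop_of_le_hasDerivAt (c := c / 2 * L) (by positivity) hM fun t ht => ?_
    refine le_trans ?_ (hM' t ht)
    exact mul_le_mul_of_nonneg_left (hV t ht) (by positivity)
  obtain ⟨s1, hs1⟩ := eventually_atTop.1
    ((hMtop.eventually_gt_atTop 0).and (eventually_ge_atTop s))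
  have hss1 : s ≤ s1 := (hs1 s1 le_rfl).2
  have hMV : ∀ t ≥ s, M t ≤ V t := fun t ht => by
    simp only [hMdef]; linarith [hPpos t ht]
  have hE : ∀ a t : ℝ, HasDerivAt (fun t : ℝ => Real.exp (-a * t))
      (Real.exp (-a * t) * (-a)) t := by
    intro a t
    have h1 : HasDerivAt (fun t : ℝ => -a * t) (-a) t := by
      simpa using (hasDerivAt_id t).const_mul (-a)
    exact h1.exp
  have hmono := monotoneOn_Ici_of_hasDerivAt (s := s1)
    (f := fun t => Real.exp (-(c / 2) * t) * M t)
    (fun t ht => (hE (c / 2) t).mul (hM t (hss1.trans ht))) (fun t ht => by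
      have h1 := hM' t (hss1.trans ht)
      have h2 := hMV t (hss1.trans ht)
      have h3 := mul_nonneg (Real.exp_pos (-(c / 2) * t)).le
        (a := Real.exp (-(c / 2) * t))
        (b := (δ - α - ε t) * V t - (δ - n) * U t ^ (p - 1) - c / 2 * M t) (by nlinarith)
      linarith)
  set A := Real.exp (-(c / 2) * s1) * M s1 with hA
  have hApos : 0 < A := mul_pos (Real.exp_pos _) (hs1 s1 le_rfl).1
  have hVA : ∀ t ≥ s1, A * Real.exp (c / 2 * t) ≤ V t := by
    intro t ht
    have h1 : A ≤ Real.exp (-(c / 2) * t) * M t := hmono self_mem_Ici ht ht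
    refine le_trans ?_ (hMV t (hss1.trans ht))
    calc A * Real.exp (c / 2 * t) ≤ Real.exp (-(c / 2) * t) * M t * Real.exp (c / 2 * t) := by
          gcongr
      _ = Real.exp (-(c / 2) * t + c / 2 * t) * M t := by rw [Real.exp_add]; ring
      _ = M t := by simp
  set k1 := c / 2 * (2 - p) with hk1
  have hk1pos : 0 < k1 := mul_pos (by positivity) (by linarith)
  set B := δ ^ (p - 1) * A ^ (p - 2) with hB
  have hBpos : 0 < B := by positivity
  have hPB : ∀ t ≥ s1, U t ^ (p - 1) ≤ B * Real.exp (-k1 * t) * V t := by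
    intro t ht
    have hv := hVpos t (hss1.trans ht)
    have h1 : V t ^ (p - 2) ≤ A ^ (p - 2) * Real.exp (-k1 * t) := by
      calc V t ^ (p - 2) ≤ (A * Real.exp (c / 2 * t)) ^ (p - 2) :=
            Real.rpow_le_rpow_of_nonpos (by positivity) (hVA t ht) (by linarith)
        _ = A ^ (p - 2) * Real.exp (-k1 * t) := by
            rw [Real.mul_rpow hApos.le (Real.exp_pos _).le, ← Real.exp_mul]
            congr 2
            simp only [hk1]; ring
    calc U t ^ (p - 1) ≤ (δ * V t) ^ (p - 1) := hP t (hss1.trans ht)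
      _ = δ ^ (p - 1) * V t ^ (p - 2) * V t := by
          rw [Real.mul_rpow hδ.le hv.le, show p - 1 = p - 2 + 1 by ring,
            Real.rpow_add_one hv.ne']
          ring
      _ ≤ δ ^ (p - 1) * (A ^ (p - 2) * Real.exp (-k1 * t)) * V t := by gcongr
      _ = _ := by simp only [hB]; ring
  have hsmall : ∀ᶠ t in atTop, B * Real.exp (-k1 * t) ≤ 1 / 2 := by
    have := (tendsto_exp_neg_mul_atTop hk1pos).const_mul B
    rw [mul_zero] at this
    exact this.eventually (eventually_le_nhds (by norm_num))
  obtain ⟨s2, hs2⟩ := eventually_atTop.1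
    ((hsmall.and (eventually_ge_atTop s1)).and (eventually_ge_atTop 0))
  have hs12 : s1 ≤ s2 := (hs2 s2 le_rfl).1.2
  set k2 := min k1 k
  have hk2pos : 0 < k2 := lt_min hk1pos h.k_pos
  set C := 2 * (|n - α| * B + 1) with hC
  have hCnn : 0 ≤ C := by positivity
  obtain ⟨c0, hc0, hm0⟩ := exists_pos_le_of_logDeriv_ge (s := s2)
    (m := fun t => Real.exp (-(δ - α) * t) * M t) hCnn hk2pos
    (fun t ht => (hE (δ - α) t).mul (hM t (hss1.trans (hs12.trans ht))))
    (fun t ht => mul_pos (Real.exp_pos _) (hs1 t (hs12.trans ht)).1) (by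
      intro t ht
      have hts1 := hs12.trans ht
      have hts := hss1.trans hts1
      obtain ⟨⟨ha, -⟩, ht0⟩ := hs2 t ht
      have hv := hVpos t hts
      have hPt := hPB t hts1
      have hPp := hPpos t hts
      have he := (h.ε_le t (hs.trans hts))
      have he1 : Real.exp (-k1 * t) ≤ Real.exp (-k2 * t) := Real.exp_le_exp.2 (by
        nlinarith [min_le_left k1 k])
      have he2 : Real.exp (-k * t) ≤ Real.exp (-k2 * t) := Real.exp_le_exp.2 (by
        nlinarith [min_le_right k1 k])
      set e := Real.exp (-k2 * t)
      have hepos : 0 < e := Real.exp_pos _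
      have hMt : V t ≤ 2 * M t := by
        simp only [hMdef]
        nlinarith
      have h1 : U t ^ (p - 1) ≤ B * e * V t :=
        hPt.trans (by gcongr)
      have h2 : -(|n - α| * (B * e * V t)) ≤ (n - α) * U t ^ (p - 1) := by
        have h3 : |n - α| * U t ^ (p - 1) ≤ |n - α| * (B * e * V t) :=
          mul_le_mul_of_nonneg_left h1 (abs_nonneg _)
        nlinarith [neg_abs_le (n - α)]
      have h4 : ε t * V t ≤ e * V t := mul_le_mul_of_nonneg_right (he.trans he2) hv.le
      have h5 : (|n - α| * B + 1) * e * V t ≤ (|n - α| * B + 1) * e * (2 * M t) :=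
        mul_le_mul_of_nonneg_left hMt (by positivity)
      have h6 : 0 ≤ (n - α) * U t ^ (p - 1) - ε t * V t + C * e * M t := by
        simp only [hC]
        linarith
      have h7 := mul_nonneg (Real.exp_pos (-(δ - α) * t)).le h6
      have h8 : M t = V t - U t ^ (p - 1) := rfl
      rw [h8] at h7 ⊢
      linarith)
  have hle : c0 ≤ 0 := by
    refine ge_of_tendsto h.decay ?_
    filter_upwards [eventually_ge_atTop s2] with t ht
    refine (hm0 t ht).trans ?_
    exact mul_le_mul_of_nonneg_left (hMV t (hss1.trans (hs12.trans ht))) (Real.exp_pos _).le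
  linarith

lemma not_decreasing_above (h : LogFlow n p α δ k T V U ε) {L c s : ℝ} (hL : 0 < L) (hc : 0 < c)
    (hLc : ∀ x ≥ L, (δ - n) * (δ * x) ^ (p - 1) ≤ (δ - α - c) * x)
    (hs : T ≤ s) (hε : ∀ t ≥ s, ε t ≤ c / 2) (hV : ∀ t ≥ s, L ≤ V t)
    (hU : ∀ t ≥ s, δ * V t ≤ U t) : False := by
  have hδ := h.δ_pos
  have hα := h.α_pos
  have hbot : Tendsto (fun t => U t ^ (p - 1)) atTop atBot := by
    refine tendsto_atBot_of_hasDerivAt_le (s := s) (c := c / 2 * L) (by positivity)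
      (fun t ht => h.hasDerivAt_P t (hs.trans ht)) fun t ht => ?_
    have hv := h.V_pos t (hs.trans ht)
    have hx : V t ≤ U t / δ := by rw [le_div_iff₀ hδ]; linarith [hU t ht]
    have h1 := hLc (U t / δ) ((hV t ht).trans hx)
    rw [mul_div_cancel₀ _ hδ.ne'] at h1
    have h2 : (δ - α - c) * (U t / δ) = U t - (α + c) * (U t / δ) := by field_simp; ring
    rw [h2] at h1
    have h3 := mul_le_mul_of_nonneg_left hx (by positivity : 0 ≤ α + c)
    have h4 := mul_le_mul_of_nonneg_right (hε t ht) hv.le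
    have h5 := mul_le_mul_of_nonneg_left (hV t ht) (by positivity : 0 ≤ c / 2)
    linarith
  obtain ⟨t, h1, h2⟩ := ((hbot.eventually_lt_atBot 0).and (eventually_ge_atTop T)).exists
  exact absurd (Real.rpow_pos_of_pos (h.U_pos t h2) (p - 1)) (not_lt.2 h1.le)

/-- Above the critical level `V` is strictly decreasing. -/
lemma lt_of_level_le (h : LogFlow n p α δ k T V U ε) {c s : ℝ} (hc : 0 < c) (hcδ : c ≤ δ - α)
    (hs : T ≤ s) (hLc : ∀ x ≥ V s, (δ - n) * (δ * x) ^ (p - 1) ≤ (δ - α - c) * x)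
    (hε : ∀ t ≥ s, ε t ≤ c / 2) : δ * V s < U s := by
  by_contra! hcon
  have hδ := h.δ_pos
  have hmono : ∀ t, (∀ τ ∈ Icc s t, U τ ≤ δ * V τ) → s ≤ t → V s ≤ V t := by
    intro t ht hst
    refine monotoneOn_of_hasDerivWithinAt_nonneg (f' := fun t => δ * V t - U t) (convex_Icc s t)
      (fun τ hτ => (h.hasDerivAt_V τ (hs.trans hτ.1)).continuousAt.continuousWithinAt)
      (fun τ hτ => (h.hasDerivAt_V τ (hs.trans (interior_subset hτ).1)).hasDerivWithinAt)
      (fun τ hτ => sub_nonneg.2 (ht τ (interior_subset hτ))) ⟨le_rfl, hst⟩ ⟨hst, le_rfl⟩ hst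
  have key : ∀ t ≥ s, 0 ≤ (δ * V t) ^ (p - 1) - U t ^ (p - 1) := by
    refine nonneg_of_hasDerivAt_pos_of_eq_zero
      (fun t ht => h.hasDerivAt_D t (hs.trans ht)) (sub_nonneg.2 ((h.le_iff_rpow hs).1 hcon)) ?_
    intro t ht hτ h0
    have hTt := hs.trans ht
    have hv := h.V_pos t hTt
    have hVs := hmono t
      (fun τ hτ' => (h.le_iff_rpow (hs.trans hτ'.1)).2 (sub_nonneg.1 (hτ τ hτ'))) ht
    have hU : U t = δ * V t := le_antisymm ((h.le_iff_rpow hTt).2 (by linarith))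
      ((h.ge_iff_rpow hTt).2 (by linarith))
    have h1 := hLc _ hVs
    have h2 := mul_le_mul_of_nonneg_right (hε t ht) hv.le
    rw [hU, sub_self, mul_zero, zero_mul, zero_mul]
    nlinarith
  have hUV : ∀ t ≥ s, U t ≤ δ * V t := fun t ht =>
    (h.le_iff_rpow (hs.trans ht)).2 (sub_nonneg.1 (key t ht))
  exact h.not_increasing_above (h.V_pos s hs) hc hcδ hLc hs hε
    (fun t ht => hmono t (fun τ hτ => hUV τ hτ.1) ht) hUV

lemma eventually_le_level (h : LogFlow n p α δ k T V U ε) {L c : ℝ} (hL : 0 < L) (hc : 0 < c)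
    (hcδ : c ≤ δ - α) (hLc : ∀ x ≥ L, (δ - n) * (δ * x) ^ (p - 1) ≤ (δ - α - c) * x) :
    ∀ᶠ t in atTop, V t ≤ L := by
  obtain ⟨s, hs⟩ := eventually_atTop.1
    ((h.eventually_ε_le (half_pos hc)).and (eventually_ge_atTop T))
  have hTs : T ≤ s := (hs s le_rfl).2
  have hlt : ∀ t ≥ s, L ≤ V t → δ * V t < U t := fun t ht hLt =>
    h.lt_of_level_le hc hcδ (hTs.trans ht) (fun x hx => hLc x (hLt.trans hx))
      (fun τ hτ => (hs τ (le_trans ht hτ)).1)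
  have hex : ∃ s1 ≥ s, V s1 ≤ L := by
    by_contra! hcon
    exact h.not_decreasing_above hL hc hLc hTs (fun t ht => (hs t ht).1)
      (fun t ht => (hcon t ht).le) (fun t ht => (hlt t ht (hcon t ht).le).le)
  obtain ⟨s1, hs1, hV1⟩ := hex
  filter_upwards [eventually_ge_atTop s1] with t ht
  have := nonneg_of_hasDerivAt_pos_of_eq_zero (s := s1) (f := fun t => L - V t)
    (fun t ht => (h.hasDerivAt_V t (hTs.trans (le_trans hs1 ht))).const_sub L)
    (sub_nonneg.2 hV1) (fun t ht _ h0 => by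
      linarith [hlt t (le_trans hs1 ht) (sub_eq_zero.1 h0).le]) t ht
  exact sub_nonneg.1 this

lemma not_decreasing_below (h : LogFlow n p α δ k T V U ε) {L c s : ℝ} (hc : 0 < c)
    (hLc : ∀ x, 0 < x → x ≤ L → (δ - α + c) * x ≤ (δ - n) * (δ * x) ^ (p - 1)) (hnδ : n ≤ δ)
    (hs : T ≤ s) (hV : ∀ t ≥ s, V t ≤ L) (hU : ∀ t ≥ s, δ * V t ≤ U t) : False := by
  have hδ := h.δ_pos
  have hp := h.one_lt_p
  have hp2 := h.p_lt_two
  have hVpos : ∀ t ≥ s, 0 < V t := fun t ht => h.V_pos t (hs.trans ht)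
  have hP : ∀ t ≥ s, (δ * V t) ^ (p - 1) ≤ U t ^ (p - 1) := fun t ht =>
    (h.ge_iff_rpow (hs.trans ht)).1 (hU t ht)
  have hVd : ∀ t ≥ s, HasDerivAt V (δ * V t - U t) t := fun t ht =>
    h.hasDerivAt_V t (hs.trans ht)
  have hanti : AntitoneOn V (Ici s) := antitoneOn_Ici_of_hasDerivAt hVd
    fun t ht => by linarith [hU t ht]
  have hM := fun t (ht : t ≥ s) => h.hasDerivAt_M t (hs.trans ht)
  have hM' : ∀ t ≥ s, (δ - α - ε t) * V t - (δ - n) * U t ^ (p - 1) ≤ -c * V t := by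
    intro t ht
    have h1 := hLc _ (hVpos t ht) (hV t ht)
    have h2 := mul_le_mul_of_nonneg_left (hP t ht) (sub_nonneg.2 hnδ)
    have h3 := mul_nonneg (h.ε_nonneg t (hs.trans ht)) (hVpos t ht).le
    linarith
  have hno : ∀ ν > 0, ¬ ∀ᶠ t in atTop, δ * V t + ν ≤ U t := by
    intro ν hν hev
    obtain ⟨s', hs'⟩ := eventually_atTop.1 (hev.and (eventually_ge_atTop s))
    have := tendsto_atBot_of_hasDerivAt_le hν (fun t ht => hVd t (hs' t ht).2)
      (fun t ht => by linarith [(hs' t ht).1])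
    obtain ⟨t, h1, h2⟩ := ((this.eventually_lt_atBot 0).and (eventually_ge_atTop s)).exists
    linarith [hVpos t h2]
  by_cases hb : ∃ v > 0, ∀ t ≥ s, v ≤ V t
  · obtain ⟨v, hv, hvV⟩ := hb
    have hbot := tendsto_atBot_of_hasDerivAt_le (c := c * v) (by positivity) hM fun t ht => by
      nlinarith [hM' t ht, hvV t ht]
    refine hno 1 one_pos ?_
    have hX : 0 < δ * L + 1 := by
      have := (hVpos s le_rfl).trans_le (hV s le_rfl)
      positivity
    filter_upwards [hbot.eventually_le_atBot (-((δ * L + 1) ^ (p - 1))),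
      eventually_ge_atTop s] with t h1 h2
    have h3 : (δ * L + 1) ^ (p - 1) ≤ U t ^ (p - 1) := by linarith [hVpos t h2]
    have h4 := (Real.rpow_le_rpow_iff hX.le (h.U_pos t (hs.trans h2)).le (by linarith)).1 h3
    nlinarith [hV t h2]
  · push Not at hb
    have hV0 : ∀ v > 0, ∀ᶠ t in atTop, V t ≤ v := by
      intro v hv
      obtain ⟨t, ht, htv⟩ := hb v hv
      filter_upwards [eventually_ge_atTop t] with τ hτ
      exact (hanti ht (le_trans ht hτ) hτ).trans htv.le
    have hx : 0 < (δ ^ (p - 1) / 2) ^ (1 / (2 - p)) := by positivity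
    obtain ⟨s1, hs1V, hs1⟩ := ((hV0 _ hx).and (eventually_ge_atTop s)).exists
    have hMneg : V s1 - U s1 ^ (p - 1) < 0 := by
      have hv := hVpos s1 hs1
      have h1 : V s1 ^ (2 - p) ≤ δ ^ (p - 1) / 2 := by
        calc V s1 ^ (2 - p) ≤ ((δ ^ (p - 1) / 2) ^ (1 / (2 - p))) ^ (2 - p) :=
              Real.rpow_le_rpow hv.le hs1V (by linarith)
          _ = _ := by
              rw [← Real.rpow_mul (by positivity), one_div_mul_cancel (by linarith),
                Real.rpow_one]
      have h2 : V s1 = V s1 ^ (2 - p) * V s1 ^ (p - 1) := by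
        rw [← Real.rpow_add hv]; norm_num
      have h3 := hP s1 hs1
      rw [Real.mul_rpow hδ.le hv.le] at h3
      have h4 : 0 < V s1 ^ (p - 1) := by positivity
      have h5 : 0 < δ ^ (p - 1) := by positivity
      nlinarith [mul_le_mul_of_nonneg_right h1 h4.le]
    set μ := -(V s1 - U s1 ^ (p - 1)) with hμ
    have hμpos : 0 < μ := by linarith
    have hMle : ∀ t ≥ s1, V t - U t ^ (p - 1) ≤ -μ := by
      intro t ht
      have := antitoneOn_Ici_of_hasDerivAt (s := s1) (fun t ht => hM t (le_trans hs1 ht))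
        (fun t ht => (hM' t (le_trans hs1 ht)).trans (by
          nlinarith [hVpos t (le_trans hs1 ht)])) self_mem_Ici ht ht
      simp only at this
      linarith
    set ν := μ ^ (1 / (p - 1)) / 2 with hν
    have hνpos : 0 < ν := by positivity
    refine hno ν hνpos ?_
    filter_upwards [hV0 (ν / δ) (by positivity), eventually_ge_atTop s1] with t h1 h2
    have h3 : (2 * ν) ^ (p - 1) ≤ U t ^ (p - 1) := by
      rw [hν, mul_div_cancel₀ _ two_ne_zero, ← Real.rpow_mul hμpos.le,
        one_div_mul_cancel (by linarith), Real.rpow_one]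
      linarith [hMle t h2, hVpos t (le_trans hs1 h2)]
    have h4 := (Real.rpow_le_rpow_iff (by positivity)
      (h.U_pos t (hs.trans (le_trans hs1 h2))).le (by linarith)).1 h3
    rw [le_div_iff₀ hδ] at h1
    linarith

lemma not_increasing_below (h : LogFlow n p α δ k T V U ε) {L c s : ℝ} (hc : 0 < c)
    (hcα : c ≤ α)
    (hLc : ∀ x, 0 < x → x ≤ L → (δ - α + c) * x ≤ (δ - n) * (δ * x) ^ (p - 1))
    (hs : T ≤ s) (hV : ∀ t ≥ s, V t ≤ L) (hU : ∀ t ≥ s, U t ≤ δ * V t) : False := by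
  have hδ := h.δ_pos
  have hp := h.one_lt_p
  have hVpos : ∀ t ≥ s, 0 < V t := fun t ht => h.V_pos t (hs.trans ht)
  have hmono : MonotoneOn V (Ici s) := monotoneOn_Ici_of_hasDerivAt
    (fun t ht => h.hasDerivAt_V t (hs.trans ht)) fun t ht => by linarith [hU t ht]
  have htop : Tendsto (fun t => U t ^ (p - 1)) atTop atTop := by
    refine tendsto_atTop_of_le_hasDerivAt (s := s) (c := c * V s)
      (mul_pos hc (hVpos s le_rfl)) (fun t ht => h.hasDerivAt_P t (hs.trans ht)) fun t ht => ?_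
    have hu := h.U_pos t (hs.trans ht)
    have hx : U t / δ ≤ V t := by rw [div_le_iff₀ hδ]; linarith [hU t ht]
    have h1 := hLc (U t / δ) (by positivity) (hx.trans (hV t ht))
    rw [mul_div_cancel₀ _ hδ.ne'] at h1
    have h2 : (δ - α + c) * (U t / δ) = U t - (α - c) * (U t / δ) := by field_simp; ring
    rw [h2] at h1
    have h3 := mul_le_mul_of_nonneg_left hx (sub_nonneg.2 hcα)
    have h4 := mul_nonneg (h.ε_nonneg t (hs.trans ht)) (hVpos t ht).le
    have h5 := mul_le_mul_of_nonneg_left (hmono self_mem_Ici ht ht) hc.le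
    linarith
  obtain ⟨t, h1, h2⟩ := ((htop.eventually_gt_atTop ((δ * L) ^ (p - 1))).and
    (eventually_ge_atTop s)).exists
  have h3 : U t ≤ δ * L := (hU t h2).trans (mul_le_mul_of_nonneg_left (hV t h2) hδ.le)
  exact absurd (Real.rpow_le_rpow (h.U_pos t (hs.trans h2)).le h3 (by linarith : 0 ≤ p - 1))
    (not_le.2 h1)

lemma eventually_level_le (h : LogFlow n p α δ k T V U ε) {L c : ℝ} (hc : 0 < c)
    (hcα : c ≤ α) (hnδ : n ≤ δ)
    (hLc : ∀ x, 0 < x → x ≤ L → (δ - α + c) * x ≤ (δ - n) * (δ * x) ^ (p - 1)) :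
    ∀ᶠ t in atTop, L ≤ V t := by
  have hlt : ∀ s ≥ T, V s ≤ L → U s < δ * V s := by
    intro s hs hVL
    by_contra! hcon
    have hanti : ∀ t, (∀ τ ∈ Icc s t, δ * V τ ≤ U τ) → s ≤ t → V t ≤ V s := by
      intro t ht hst
      refine antitoneOn_of_hasDerivWithinAt_nonpos (f' := fun t => δ * V t - U t) (convex_Icc s t)
        (fun τ hτ => (h.hasDerivAt_V τ (le_trans hs hτ.1)).continuousAt.continuousWithinAt)
        (fun τ hτ => (h.hasDerivAt_V τ (le_trans hs (interior_subset hτ).1)).hasDerivWithinAt)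
        (fun τ hτ => sub_nonpos.2 (ht τ (interior_subset hτ))) ⟨le_rfl, hst⟩ ⟨hst, le_rfl⟩ hst
    have key : ∀ t ≥ s, 0 ≤ -((δ * V t) ^ (p - 1) - U t ^ (p - 1)) := by
      refine nonneg_of_hasDerivAt_pos_of_eq_zero
        (fun t ht => (h.hasDerivAt_D t (le_trans hs ht)).neg)
        (by linarith [(h.ge_iff_rpow hs).1 hcon]) ?_
      intro t ht hτ h0
      have hTt := le_trans hs ht
      have hv := h.V_pos t hTt
      have hVs := hanti t
        (fun τ hτ' => (h.ge_iff_rpow (le_trans hs hτ'.1)).2 (by linarith [hτ τ hτ'])) ht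
      have hU : U t = δ * V t := le_antisymm ((h.le_iff_rpow hTt).2 (by linarith))
        ((h.ge_iff_rpow hTt).2 (by linarith))
      have h1 := hLc _ hv (hVs.trans hVL)
      have h2 := mul_nonneg (h.ε_nonneg t hTt) hv.le
      have h3 := mul_pos hc hv
      rw [hU, sub_self, mul_zero, zero_mul, zero_mul]
      linarith
    have hUV : ∀ t ≥ s, δ * V t ≤ U t := fun t ht =>
      (h.ge_iff_rpow (le_trans hs ht)).2 (by linarith [key t ht])
    exact h.not_decreasing_below hc hLc hnδ hs
      (fun t ht => (hanti t (fun τ hτ => hUV τ hτ.1) ht).trans hVL) hUV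
  have hex : ∃ s1 ≥ T, L ≤ V s1 := by
    by_contra! hcon
    exact h.not_increasing_below hc hcα hLc le_rfl
      (fun t ht => (hcon t ht).le) (fun t ht => (hlt t ht (hcon t ht).le).le)
  obtain ⟨s1, hs1, hV1⟩ := hex
  filter_upwards [eventually_ge_atTop s1] with t ht
  have := nonneg_of_hasDerivAt_pos_of_eq_zero (s := s1) (f := fun t => V t - L)
    (fun t ht => (h.hasDerivAt_V t (le_trans hs1 ht)).sub_const L)
    (sub_nonneg.2 hV1) (fun t ht _ h0 => by
      linarith [hlt t (le_trans hs1 ht) (sub_eq_zero.1 h0).le]) t ht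
  exact sub_nonneg.1 this

lemma rpow_split (h : LogFlow n p α δ k T V U ε) {x : ℝ} (hx : 0 < x) :
    (δ - n) * (δ * x) ^ (p - 1) = (δ ^ (p - 1) * (δ - n)) * x ^ (p - 2) * x := by
  rw [Real.mul_rpow h.δ_pos.le hx.le, mul_assoc _ (x ^ (p - 2)), ← Real.rpow_add_one hx.ne',
    show p - 2 + 1 = p - 1 by ring]
  ring

theorem tendsto_V_of_lt (h : LogFlow n p α δ k T V U ε) (hn : n < δ) :
    Tendsto V atTop (𝓝 ((δ ^ (p - 1) * ((δ - n) / (δ - α))) ^ (1 / (2 - p)))) := by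
  have hδ := h.δ_pos
  have hp2 := h.p_lt_two
  have hαδ := sub_pos.2 h.α_lt_δ
  have hnδ := sub_pos.2 hn
  set K := δ ^ (p - 1) * (δ - n) with hK
  have hKpos : 0 < K := by positivity
  set l := (δ ^ (p - 1) * ((δ - n) / (δ - α))) ^ (1 / (2 - p)) with hl
  have hlpos : 0 < l := by positivity
  have hl' : l ^ (p - 2) = (δ - α) / K := by
    rw [hl, ← Real.rpow_mul (by positivity), show 1 / (2 - p) * (p - 2) = -1 by
      have : 2 - p ≠ 0 := by linarith
      field_simp; ring, Real.rpow_neg_one, hK]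
    field_simp
  have hl2 : K * l ^ (p - 2) = δ - α := by rw [hl']; field_simp
  rw [tendsto_order]
  constructor
  · intro a ha
    obtain ⟨L, hL1, hL2⟩ := exists_between (max_lt ha hlpos)
    have hLpos : 0 < L := (le_max_right _ _).trans_lt hL1
    have hlt : δ - α < K * L ^ (p - 2) := by
      rw [← hl2]
      exact mul_lt_mul_of_pos_left (Real.rpow_lt_rpow_of_neg hLpos hL2 (by linarith)) hKpos
    filter_upwards [h.eventually_level_le (L := L) (c := min (K * L ^ (p - 2) - (δ - α)) α)
      (lt_min (by linarith) h.α_pos) (min_le_right _ _) hn.le (by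
        intro x hx hxL
        rw [h.rpow_split hx]
        refine mul_le_mul_of_nonneg_right ?_ hx.le
        have h1 := mul_le_mul_of_nonneg_left
          (Real.rpow_le_rpow_of_nonpos hx hxL (by linarith : p - 2 ≤ 0)) hKpos.le
        linarith [min_le_left (K * L ^ (p - 2) - (δ - α)) α])] with t ht
    exact ((le_max_left _ _).trans_lt hL1).trans_le ht
  · intro a ha
    obtain ⟨L, hL1, hL2⟩ := exists_between (show l < a from ha)
    have hLpos : 0 < L := hlpos.trans hL1
    have hlt : K * L ^ (p - 2) < δ - α := by
      rw [← hl2]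
      exact mul_lt_mul_of_pos_left (Real.rpow_lt_rpow_of_neg hlpos hL1 (by linarith)) hKpos
    have hKL : 0 < K * L ^ (p - 2) := by positivity
    filter_upwards [h.eventually_le_level (L := L) (c := δ - α - K * L ^ (p - 2)) hLpos
      (by linarith) (by linarith) (by
        intro x hx
        have hx0 := hLpos.trans_le hx
        rw [h.rpow_split hx0]
        refine mul_le_mul_of_nonneg_right ?_ hx0.le
        have h1 := mul_le_mul_of_nonneg_left
          (Real.rpow_le_rpow_of_nonpos hLpos hx (by linarith : p - 2 ≤ 0)) hKpos.le
        linarith)] with t ht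
    exact lt_of_le_of_lt ht hL2

lemma level_bound_of_le (h : LogFlow n p α δ k T V U ε) (hn : δ ≤ n) {x : ℝ} (hx : 0 < x) :
    (δ - n) * (δ * x) ^ (p - 1) ≤ (δ - α - (δ - α)) * x := by
  rw [sub_self, zero_mul]
  exact mul_nonpos_of_nonpos_of_nonneg (by linarith)
    (Real.rpow_nonneg (mul_nonneg h.δ_pos.le hx.le) _)

lemma tendsto_V_zero (h : LogFlow n p α δ k T V U ε) (hn : δ ≤ n) :
    Tendsto V atTop (𝓝 0) := by
  have hαδ := sub_pos.2 h.α_lt_δ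
  rw [tendsto_order]
  constructor
  · intro a ha
    filter_upwards [eventually_ge_atTop T] with t ht using ha.trans (h.V_pos t ht)
  · intro a (ha : 0 < a)
    filter_upwards [h.eventually_le_level (half_pos ha) hαδ le_rfl
      (fun x hx => h.level_bound_of_le hn ((half_pos ha).trans_le hx))] with t ht
    linarith

lemma eventually_lt_U (h : LogFlow n p α δ k T V U ε) (hn : δ ≤ n) :
    ∀ᶠ t in atTop, δ * V t < U t := by
  have hαδ := sub_pos.2 h.α_lt_δ
  obtain ⟨s, hs⟩ := eventually_atTop.1
    ((h.eventually_ε_le (half_pos hαδ)).and (eventually_ge_atTop T))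
  filter_upwards [eventually_ge_atTop s] with t ht
  exact h.lt_of_level_le hαδ le_rfl (hs t ht).2
    (fun x hx => h.level_bound_of_le hn ((h.V_pos t (hs t ht).2).trans_le hx))
    (fun τ hτ => (hs τ (le_trans ht hτ)).1)

lemma V_le_mul_P (h : LogFlow n p α δ k T V U ε) {t : ℝ} (ht : T ≤ t) (hU : δ * V t < U t) :
    V t ≤ (δ ^ (p - 1))⁻¹ * V t ^ (2 - p) * U t ^ (p - 1) := by
  have hv := h.V_pos t ht
  have hδ := h.δ_pos
  have h1 := (h.ge_iff_rpow ht).1 hU.le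
  rw [Real.mul_rpow hδ.le hv.le] at h1
  have h2 : V t ^ (2 - p) * V t ^ (p - 1) = V t := by
    rw [← Real.rpow_add hv]; norm_num
  have h3 : 0 < δ ^ (p - 1) := by positivity
  calc V t = (δ ^ (p - 1))⁻¹ * V t ^ (2 - p) * (δ ^ (p - 1) * V t ^ (p - 1)) := by
        field_simp
        exact h2.symm
    _ ≤ _ := by gcongr

lemma tendsto_V_div_P (h : LogFlow n p α δ k T V U ε) (hn : δ ≤ n) :
    Tendsto (fun t => V t / U t ^ (p - 1)) atTop (𝓝 0) := by
  have hp2 := h.p_lt_two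
  have h1 : Tendsto (fun t => (δ ^ (p - 1))⁻¹ * V t ^ (2 - p)) atTop (𝓝 0) := by
    have := ((h.tendsto_V_zero hn).rpow_const (p := 2 - p) (Or.inr (by linarith))).const_mul
      (δ ^ (p - 1))⁻¹
    rwa [Real.zero_rpow (by linarith), mul_zero] at this
  refine squeeze_zero' ?_ ?_ h1
  · filter_upwards [eventually_ge_atTop T] with t ht
    exact div_nonneg (h.V_pos t ht).le (Real.rpow_nonneg (h.U_pos t ht).le _)
  · filter_upwards [eventually_ge_atTop T, h.eventually_lt_U hn] with t ht hU
    rw [div_le_iff₀ (Real.rpow_pos_of_pos (h.U_pos t ht) _)]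
    exact h.V_le_mul_P ht hU

/-- From some time on `P = U ^ (p - 1)` dominates `V` and the lower order terms are harmless. -/
lemma exists_dominated (h : LogFlow n p α δ k T V U ε) (hn : δ ≤ n) :
    ∃ s ≥ T, ∀ t ≥ s, δ * V t < U t ∧ V t ≤ U t ^ (p - 1) / 2 ∧ ε t ≤ n - α := by
  have hαn : 0 < n - α := by linarith [h.α_lt_δ]
  obtain ⟨s, hs⟩ := eventually_atTop.1 ((h.eventually_lt_U hn).and
    (((h.tendsto_V_div_P hn).eventually (eventually_le_nhds (b := 1 / 2) (by norm_num))).and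
      (h.eventually_ε_le hαn)))
  refine ⟨max s T, le_max_right _ _, fun t ht => ?_⟩
  have hTt : T ≤ t := (le_max_right _ _).trans ht
  obtain ⟨h1, h2, h3⟩ := hs t (le_trans (le_max_left _ _) ht)
  rw [div_le_iff₀ (Real.rpow_pos_of_pos (h.U_pos t hTt) _)] at h2
  exact ⟨h1, by linarith, h3⟩

theorem exists_tendsto_of_gt (h : LogFlow n p α δ k T V U ε) (hn : δ < n) :
    ∃ c : ℝ, 0 < c ∧
      Tendsto (fun t => Real.exp ((n - δ) / (p - 1) * t) * V t) atTop (𝓝 c) := by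
  have hδ := h.δ_pos
  have hα := h.α_pos
  have hp := h.one_lt_p
  have hp2 := h.p_lt_two
  have hp1 : 0 < p - 1 := by linarith
  set ρ := (n - δ) / (p - 1) with hρ
  have hρpos : 0 < ρ := div_pos (by linarith) hp1
  have hρp : ρ * (p - 1) = n - δ := by rw [hρ]; field_simp
  have hE : ∀ a t : ℝ, HasDerivAt (fun t : ℝ => Real.exp (a * t)) (Real.exp (a * t) * a) t := by
    intro a t
    have h1 : HasDerivAt (fun t : ℝ => a * t) a t := by
      simpa using (hasDerivAt_id t).const_mul a
    exact h1.exp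
  obtain ⟨s, hTs, hs⟩ := h.exists_dominated hn.le
  have hv : ∀ t ≥ s, 0 < V t := fun t ht => h.V_pos t (hTs.trans ht)
  have hu : ∀ t ≥ s, 0 < U t := fun t ht => h.U_pos t (hTs.trans ht)
  have hPpos : ∀ t ≥ s, 0 < U t ^ (p - 1) := fun t ht => Real.rpow_pos_of_pos (hu t ht) _
  set J : ℝ → ℝ := fun t => Real.exp ((n - δ) * t) * -(V t - U t ^ (p - 1)) with hJdef
  have hJ : ∀ t ≥ s, HasDerivAt J (-((n - α - ε t) * (Real.exp ((n - δ) * t) * V t))) t := by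
    intro t ht
    refine ((hE (n - δ) t).mul (h.hasDerivAt_M t (hTs.trans ht)).neg).congr_deriv ?_
    simp only [Pi.neg_apply]
    ring
  have hJanti : AntitoneOn J (Ici s) := antitoneOn_Ici_of_hasDerivAt hJ fun t ht => by
    have := mul_nonneg (sub_nonneg.2 (hs t ht).2.2)
      (mul_pos (Real.exp_pos ((n - δ) * t)) (hv t ht)).le
    linarith
  have hPJ : ∀ t ≥ s, Real.exp ((n - δ) * t) * U t ^ (p - 1) ≤ 2 * J t := by
    intro t ht
    have := mul_le_mul_of_nonneg_left (hs t ht).2.1 (Real.exp_pos ((n - δ) * t)).le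
    simp only [hJdef]
    linarith
  have hJpos : ∀ t ≥ s, 0 < J t := fun t ht => by
    have := mul_pos (Real.exp_pos ((n - δ) * t)) (hPpos t ht)
    linarith [hPJ t ht]
  have hUexp : ∀ t ≥ s, Real.exp (ρ * t) * U t
      = (Real.exp ((n - δ) * t) * U t ^ (p - 1)) ^ (1 / (p - 1)) := by
    intro t ht
    rw [Real.mul_rpow (Real.exp_pos _).le (hPpos t ht).le, ← Real.exp_mul,
      ← Real.rpow_mul (hu t ht).le, mul_one_div_cancel hp1.ne', Real.rpow_one]
    congr 2
    rw [hρ]; ring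
  set C1 := (2 * J s) ^ (1 / (p - 1)) with hC1
  have hUC : ∀ t ≥ s, Real.exp (ρ * t) * U t ≤ C1 := by
    intro t ht
    rw [hUexp t ht]
    refine Real.rpow_le_rpow (mul_pos (Real.exp_pos _) (hPpos t ht)).le ?_ (by positivity)
    linarith [hPJ t ht, hJanti self_mem_Ici ht ht]
  set X : ℝ → ℝ := fun t => Real.exp (ρ * t) * V t with hXdef
  have hX : ∀ t ≥ s, HasDerivAt X ((δ + ρ) * X t - Real.exp (ρ * t) * U t) t := by
    intro t ht
    refine ((hE ρ t).mul (h.hasDerivAt_V t (hTs.trans ht))).congr_deriv ?_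
    simp only [hXdef]
    ring
  have hX0 : Tendsto (fun t => Real.exp (-(δ + ρ) * t) * X t) atTop (𝓝 0) := by
    have := (tendsto_exp_neg_mul_atTop hδ).mul (h.tendsto_V_zero hn.le)
    rw [mul_zero] at this
    refine this.congr fun t => ?_
    simp only [hXdef]
    rw [← mul_assoc, ← Real.exp_add]
    congr 2
    ring
  have hδρ : 0 < δ + ρ := by positivity
  have hXC := le_div_of_unstable hδρ hX hX0 hUC
  set C2 := C1 / (δ + ρ) with hC2
  have hC2pos : 0 < C2 := lt_of_lt_of_le (mul_pos (Real.exp_pos _) (hv s le_rfl)) (hXC s le_rfl)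
  have hVC : ∀ t ≥ s, V t ≤ C2 * Real.exp (-ρ * t) := by
    intro t ht
    have h1 := mul_le_mul_of_nonneg_right (hXC t ht) (Real.exp_pos (-ρ * t)).le
    refine le_trans (le_of_eq ?_) h1
    simp only [hXdef]
    rw [mul_right_comm, ← Real.exp_add]
    simp
  set k1 := ρ * (2 - p) with hk1
  have hk1pos : 0 < k1 := mul_pos hρpos (by linarith)
  set B := (δ ^ (p - 1))⁻¹ * C2 ^ (2 - p) with hB
  have hVB : ∀ t ≥ s, V t ≤ B * Real.exp (-k1 * t) * U t ^ (p - 1) := by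
    intro t ht
    refine (h.V_le_mul_P (hTs.trans ht) (hs t ht).1).trans ?_
    have h1 : V t ^ (2 - p) ≤ C2 ^ (2 - p) * Real.exp (-k1 * t) := by
      calc V t ^ (2 - p) ≤ (C2 * Real.exp (-ρ * t)) ^ (2 - p) :=
            Real.rpow_le_rpow (hv t ht).le (hVC t ht) (by linarith)
        _ = _ := by
            rw [Real.mul_rpow hC2pos.le (Real.exp_pos _).le, ← Real.exp_mul]
            congr 2
            simp only [hk1]; ring
    have := (hPpos t ht).le
    calc _ ≤ (δ ^ (p - 1))⁻¹ * (C2 ^ (2 - p) * Real.exp (-k1 * t)) * U t ^ (p - 1) := by gcongr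
      _ = _ := by simp only [hB]; ring
  have hnpos : 0 < n := by linarith
  obtain ⟨j, hj, hjJ⟩ := exists_pos_le_of_logDeriv_ge (C := 2 * n * B) (by positivity) hk1pos
    hJ hJpos (by
      intro t ht
      have hexp := Real.exp_pos ((n - δ) * t)
      have h1 : Real.exp ((n - δ) * t) * V t ≤ B * Real.exp (-k1 * t) * (2 * J t) := by
        calc _ ≤ Real.exp ((n - δ) * t) * (B * Real.exp (-k1 * t) * U t ^ (p - 1)) :=
              mul_le_mul_of_nonneg_left (hVB t ht) hexp.le
          _ = B * Real.exp (-k1 * t) * (Real.exp ((n - δ) * t) * U t ^ (p - 1)) := by ring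
          _ ≤ _ := mul_le_mul_of_nonneg_left (hPJ t ht) (by positivity)
      have h2 : (n - α - ε t) * (Real.exp ((n - δ) * t) * V t)
          ≤ n * (Real.exp ((n - δ) * t) * V t) :=
        mul_le_mul_of_nonneg_right (by linarith [h.ε_nonneg t (hTs.trans ht)])
          (mul_pos hexp (hv t ht)).le
      have h3 := mul_le_mul_of_nonneg_left h1 hnpos.le
      linarith)
  obtain ⟨j', hjj', hlim⟩ := exists_tendsto_of_antitoneOn_Ici hJanti hjJ
  have hj'pos : 0 < j' := hj.trans_le hjj'
  have hVlim : Tendsto (fun t => Real.exp ((n - δ) * t) * V t) atTop (𝓝 0) := by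
    have h1 := (tendsto_exp_neg_mul_atTop hk1pos).const_mul C2
    rw [mul_zero] at h1
    refine squeeze_zero' ?_ ?_ h1
    · filter_upwards [eventually_ge_atTop s] with t ht using
        (mul_pos (Real.exp_pos _) (hv t ht)).le
    · filter_upwards [eventually_ge_atTop s] with t ht
      refine (mul_le_mul_of_nonneg_left (hVC t ht) (Real.exp_pos _).le).trans (le_of_eq ?_)
      rw [mul_left_comm, ← Real.exp_add]
      congr 2
      rw [← hρp, hk1]; ring
  have hPlim : Tendsto (fun t => Real.exp ((n - δ) * t) * U t ^ (p - 1)) atTop (𝓝 j') := by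
    have := hlim.add hVlim
    rw [add_zero] at this
    refine this.congr fun t => ?_
    simp only [hJdef]; ring
  have hUlim : Tendsto (fun t => Real.exp (ρ * t) * U t) atTop (𝓝 (j' ^ (1 / (p - 1)))) := by
    refine (hPlim.rpow_const (p := 1 / (p - 1)) (Or.inl hj'pos.ne')).congr' ?_
    filter_upwards [eventually_ge_atTop s] with t ht using (hUexp t ht).symm
  exact ⟨j' ^ (1 / (p - 1)) / (δ + ρ), by positivity,
    tendsto_div_of_unstable hδρ hX hX0 hUlim⟩

theorem tendsto_V_of_eq (h : LogFlow n p α δ k T V U ε) (hn : δ = n) :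
    Tendsto (fun t => t ^ (1 / (2 - p)) * V t) atTop
      (𝓝 (1 / n * ((2 - p) / (p - 1) * ((n - α) / n)) ^ (-(1 / (2 - p))))) := by
  subst hn
  have hδ := h.δ_pos
  have hα := h.α_pos
  have hαδ := sub_pos.2 h.α_lt_δ
  have hp := h.one_lt_p
  have hp2 := h.p_lt_two
  have hp1 : 0 < p - 1 := by linarith
  have hp3 : 0 < 2 - p := by linarith
  obtain ⟨s, hTs, hs⟩ := h.exists_dominated le_rfl
  have hv : ∀ t ≥ s, 0 < V t := fun t ht => h.V_pos t (hTs.trans ht)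
  have hu : ∀ t ≥ s, 0 < U t := fun t ht => h.U_pos t (hTs.trans ht)
  have hPpos : ∀ t ≥ s, 0 < U t ^ (p - 1) := fun t ht => Real.rpow_pos_of_pos (hu t ht) _
  set σ := 1 / (p - 1) with hσ
  have hσpos : 0 < σ := by positivity
  have hσ1 : σ - 1 = (2 - p) / (p - 1) := by rw [hσ]; field_simp; ring
  set Q : ℝ → ℝ := fun t => -(V t - U t ^ (p - 1)) with hQdef
  have hQ : ∀ t ≥ s, HasDerivAt Q (-((δ - α - ε t) * V t)) t := by
    intro t ht
    refine (h.hasDerivAt_M t (hTs.trans ht)).neg.congr_deriv ?_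
    ring
  have hPQ : ∀ t ≥ s, U t ^ (p - 1) ≤ 2 * Q t := fun t ht => by
    simp only [hQdef]; linarith [(hs t ht).2.1]
  have hQpos : ∀ t ≥ s, 0 < Q t := fun t ht => by linarith [hPQ t ht, hPpos t ht]
  have hVQ : Tendsto (fun t => V t / Q t) atTop (𝓝 0) := by
    have h1 := (h.tendsto_V_div_P le_rfl).const_mul 2
    rw [mul_zero] at h1
    refine squeeze_zero' ?_ ?_ h1
    · filter_upwards [eventually_ge_atTop s] with t ht using (div_pos (hv t ht) (hQpos t ht)).le
    · filter_upwards [eventually_ge_atTop s] with t ht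
      rw [← mul_div_assoc, div_le_div_iff₀ (hQpos t ht) (hPpos t ht)]
      nlinarith [hPQ t ht, hv t ht]
  have hUQ : Tendsto (fun t => U t * Q t ^ (-σ)) atTop (𝓝 1) := by
    have h1 := ((tendsto_const_nhds (x := (1 : ℝ))).add hVQ).rpow_const (p := σ)
      (Or.inr hσpos.le)
    rw [add_zero, Real.one_rpow] at h1
    refine h1.congr' ?_
    filter_upwards [eventually_ge_atTop s] with t ht
    have hq := hQpos t ht
    have h2 : 1 + V t / Q t = U t ^ (p - 1) / Q t := by
      field_simp
      simp only [hQdef]; ring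
    rw [h2, Real.div_rpow (hPpos t ht).le hq.le, ← Real.rpow_mul (hu t ht).le, hσ,
      mul_one_div_cancel hp1.ne', Real.rpow_one, Real.rpow_neg hq.le, div_eq_mul_inv]
  set S : ℝ → ℝ := fun t => V t * Q t ^ (-σ) with hSdef
  have hSpos : ∀ t ≥ s, 0 < S t := fun t ht =>
    mul_pos (hv t ht) (Real.rpow_pos_of_pos (hQpos t ht) _)
  have hSbd : ∀ᶠ t in atTop, S t ≤ 2 / δ := by
    filter_upwards [eventually_ge_atTop s, hUQ.eventually (eventually_le_nhds one_lt_two)]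
      with t ht h1
    rw [le_div_iff₀ hδ]
    refine le_trans ?_ h1
    have := mul_le_mul_of_nonneg_right (hs t ht).1.le (Real.rpow_pos_of_pos (hQpos t ht) (-σ)).le
    simp only [hSdef]
    linarith
  set g : ℝ → ℝ := fun t => U t * Q t ^ (-σ) - σ * (δ - α - ε t) * (V t / Q t) * S t with hg
  have hS : ∀ t ≥ s, HasDerivAt S (δ * S t - g t) t := by
    intro t ht
    have hq := hQpos t ht
    refine ((h.hasDerivAt_V t (hTs.trans ht)).mul
      ((hQ t ht).rpow_const (p := -σ) (Or.inl hq.ne'))).congr_deriv ?_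
    rw [Real.rpow_sub_one hq.ne']
    simp only [hg, hSdef]
    field_simp
    ring
  have hS0 : Tendsto (fun t => Real.exp (-δ * t) * S t) atTop (𝓝 0) := by
    have h1 := (tendsto_exp_neg_mul_atTop hδ).mul_const (2 / δ)
    rw [zero_mul] at h1
    refine squeeze_zero' ?_ ?_ h1
    · filter_upwards [eventually_ge_atTop s] with t ht using
        (mul_pos (Real.exp_pos _) (hSpos t ht)).le
    · filter_upwards [hSbd] with t ht using mul_le_mul_of_nonneg_left ht (Real.exp_pos _).le
  have hεlim : Tendsto (fun t => δ - α - ε t) atTop (𝓝 (δ - α)) := by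
    simpa using h.tendsto_ε.const_sub (δ - α)
  have hg1 : Tendsto g atTop (𝓝 1) := by
    have h1 : Tendsto (fun t => V t / Q t * S t) atTop (𝓝 0) := by
      have h2 := hVQ.mul_const (2 / δ)
      rw [zero_mul] at h2
      refine squeeze_zero' ?_ ?_ h2
      · filter_upwards [eventually_ge_atTop s] with t ht using
          (mul_pos (div_pos (hv t ht) (hQpos t ht)) (hSpos t ht)).le
      · filter_upwards [hSbd, eventually_ge_atTop s] with t h3 ht using
          mul_le_mul_of_nonneg_left h3 (div_pos (hv t ht) (hQpos t ht)).le
    have h4 := hUQ.sub ((hεlim.const_mul σ).mul h1)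
    rw [mul_zero, sub_zero] at h4
    refine h4.congr fun t => ?_
    simp only [hg]; ring
  have hSlim : Tendsto S atTop (𝓝 (1 / δ)) := tendsto_div_of_unstable hδ hS hS0 hg1
  set R : ℝ → ℝ := fun t => Q t ^ (-(σ - 1)) with hRdef
  have hR : ∀ t ≥ s, HasDerivAt R ((σ - 1) * ((δ - α - ε t) * S t)) t := by
    intro t ht
    have hq := hQpos t ht
    refine ((hQ t ht).rpow_const (p := -(σ - 1)) (Or.inl hq.ne')).congr_deriv ?_
    rw [show -(σ - 1) - 1 = -σ by ring]
    simp only [hSdef]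
    ring
  set κ := (2 - p) / (p - 1) * ((δ - α) / δ) with hκ
  have hκpos : 0 < κ := by positivity
  have hRlim : Tendsto (fun t => R t / t) atTop (𝓝 κ) := by
    refine tendsto_div_self_of_hasDerivAt hR ?_
    have := (hεlim.mul hSlim).const_mul (σ - 1)
    convert this using 2
    rw [hκ, hσ1]; ring
  have hfin := hSlim.mul (hRlim.rpow_const (p := -(1 / (2 - p))) (Or.inl hκpos.ne'))
  refine hfin.congr' ?_
  filter_upwards [eventually_ge_atTop s, eventually_gt_atTop 0] with t ht ht0
  have hq := hQpos t ht
  simp only [hSdef, hRdef]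
  rw [Real.div_rpow (Real.rpow_nonneg hq.le _) ht0.le, ← Real.rpow_mul hq.le,
    show -(σ - 1) * -(1 / (2 - p)) = σ by rw [hσ1, hσ]; field_simp,
    Real.rpow_neg ht0.le, Real.rpow_neg hq.le, div_inv_eq_mul]
  have : Q t ^ σ ≠ 0 := (Real.rpow_pos_of_pos hq _).ne'
  field_simp

end LogFlow

lemma phiP_neg (p x : ℝ) : phiP p (-x) = -phiP p x := by
  simp [phiP]

lemma phiP_eq_zero {p x : ℝ} (h : phiP p x = 0) : x = 0 := by
  by_contra hx
  exact mul_ne_zero (Real.rpow_pos_of_pos (abs_pos.2 hx) _).ne' hx h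

lemma neg_of_phiP_neg {p x : ℝ} (h : phiP p x < 0) : x < 0 := by
  by_contra! hx
  exact absurd (mul_nonneg (Real.rpow_nonneg (abs_nonneg x) (p - 2)) hx) (not_le.2 h)

lemma pos_of_phiP_pos {p x : ℝ} (h : 0 < phiP p x) : 0 < x := by
  have := neg_of_phiP_neg (p := p) (x := -x) (by rw [phiP_neg]; linarith)
  linarith

lemma phiP_of_neg {p x : ℝ} (h : x < 0) : phiP p x = -(-x) ^ (p - 1) := by
  rw [phiP, abs_of_neg h, show p - 1 = p - 2 + 1 by ring, Real.rpow_add_one (by linarith)]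
  ring

/-- `w` solves the equation on `(r₁, ∞)` with `w' = v`. -/
structure SolvesBeyond (n p q α r₁ : ℝ) (w v : ℝ → ℝ) : Prop where
  hasDerivAt : ∀ r > r₁, HasDerivAt w (v r) r
  hasDerivAt_phiP : ∀ r > r₁, HasDerivAt (fun s => phiP p (v s))
    (-((n - 1) / r * phiP p (v r) + r * v r + α * w r + |w r| ^ (q - 1) * w r)) r

namespace SolvesBeyond

variable {n p q α r₁ : ℝ} {w v : ℝ → ℝ}

lemma mono (h : SolvesBeyond n p q α r₁ w v) {r₂ : ℝ} (h12 : r₁ ≤ r₂) :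
    SolvesBeyond n p q α r₂ w v :=
  ⟨fun r hr => h.hasDerivAt r (h12.trans_lt hr), fun r hr => h.hasDerivAt_phiP r (h12.trans_lt hr)⟩

lemma neg (h : SolvesBeyond n p q α r₁ w v) :
    SolvesBeyond n p q α r₁ (fun r => -w r) (fun r => -v r) := by
  refine ⟨fun r hr => (h.hasDerivAt r hr).neg, fun r hr => ?_⟩
  simp only [phiP_neg, abs_neg]
  exact (h.hasDerivAt_phiP r hr).neg.congr_deriv (by ring)

lemma tendsto_zero (hα : 0 < α) (h0 : Tendsto (fun r => r ^ α * w r) atTop (𝓝 0)) :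
    Tendsto w atTop (𝓝 0) := by
  have := (tendsto_rpow_neg_atTop hα).mul h0
  rw [mul_zero] at this
  refine this.congr' ?_
  filter_upwards [eventually_gt_atTop 0] with r hr
  rw [← mul_assoc, ← Real.rpow_add hr]
  simp

/-- A positive solution tending to zero is eventually strictly decreasing. -/
lemma exists_deriv_neg (h : SolvesBeyond n p q α r₁ w v) (hα : 0 < α)
    (hw : ∀ r > r₁, 0 < w r) (h0 : Tendsto w atTop (𝓝 0)) : ∃ s > r₁, ∀ r > s, v r < 0 := by
  have hpos : ∀ r > r₁, phiP p (v r) = 0 →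
      0 < (n - 1) / r * phiP p (v r) + r * v r + α * w r + |w r| ^ (q - 1) * w r := by
    intro r hr hv
    have hwr := hw r hr
    rw [hv, phiP_eq_zero hv]
    have : 0 < |w r| ^ (q - 1) := Real.rpow_pos_of_pos (abs_pos.2 hwr.ne') _
    simp only [mul_zero, zero_add]
    positivity
  have hd : ∀ r > r₁, HasDerivAt (fun s => -phiP p (v s))
      ((n - 1) / r * phiP p (v r) + r * v r + α * w r + |w r| ^ (q - 1) * w r) r := fun r hr =>
    (h.hasDerivAt_phiP r hr).neg.congr_deriv (by ring)
  by_cases hex : ∃ s > r₁, 0 ≤ -phiP p (v s)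
  · obtain ⟨s, hs, hs0⟩ := hex
    have hnn := nonneg_of_hasDerivAt_pos_of_eq_zero
      (fun r hr => hd r (lt_of_lt_of_le hs hr)) hs0
      (fun r hr _ hr0 => hpos r (lt_of_lt_of_le hs hr) (neg_eq_zero.1 hr0))
    refine ⟨s, hs, fun r hr => neg_of_phiP_neg (p := p) ?_⟩
    have hr1 : r > r₁ := lt_trans hs hr
    refine lt_of_le_of_ne (neg_nonneg.1 (hnn r hr.le)) fun hz => ?_
    have hmin : IsLocalMin (fun s => -phiP p (v s)) r := by
      filter_upwards [lt_mem_nhds hr] with x hx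
      rw [hz, neg_zero]
      exact hnn x hx.le
    exact (hpos r hr1 hz).ne' (hmin.hasDerivAt_eq_zero (hd r hr1))
  · push Not at hex
    exfalso
    have hr : r₁ + 1 > r₁ := by linarith
    have hmono := monotoneOn_Ici_of_hasDerivAt (s := r₁ + 1)
      (fun r hr' => h.hasDerivAt r (lt_of_lt_of_le hr hr'))
      (fun r hr' => (pos_of_phiP_pos (p := p)
        (neg_neg_iff_pos.1 (hex r (lt_of_lt_of_le hr hr')))).le)
    refine absurd (ge_of_tendsto h0 ?_) (not_le.2 (hw _ hr))
    filter_upwards [eventually_ge_atTop (r₁ + 1)] with r hr' using hmono self_mem_Ici hr' hr'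

lemma exists_logFlow (h : SolvesBeyond n p q α r₁ w v) (hp : 1 < p) (hp2 : p < 2) (hq : 1 < q)
    (hα : 0 < α) (hαδ : α < p / (2 - p)) (hw : ∀ r > r₁, 0 < w r)
    (h0 : Tendsto (fun r => r ^ α * w r) atTop (𝓝 0)) :
    ∃ k T U ε, LogFlow n p α (p / (2 - p)) k T
      (fun t => Real.exp (p / (2 - p) * t) * w (Real.exp t)) U ε := by
  obtain ⟨s, hs, hv⟩ := h.exists_deriv_neg hα hw (tendsto_zero hα h0)
  set δ := p / (2 - p) with hδ
  have hδp : (δ + 1) * (p - 1) = δ - 1 := by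
    have : 2 - p ≠ 0 := by linarith
    rw [hδ]; field_simp; ring
  obtain ⟨T, hT⟩ := eventually_atTop.1 ((Real.tendsto_exp_atTop.eventually_gt_atTop s).and
    ((h0.comp Real.tendsto_exp_atTop).eventually (eventually_le_nhds one_pos)))
  have hTs : ∀ t ≥ T, s < Real.exp t := fun t ht => (hT t ht).1
  have hTr : ∀ t ≥ T, r₁ < Real.exp t := fun t ht => lt_trans hs (hTs t ht)
  have hE : ∀ a t : ℝ, HasDerivAt (fun t : ℝ => Real.exp (a * t)) (Real.exp (a * t) * a) t := by
    intro a t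
    have h1 : HasDerivAt (fun t : ℝ => a * t) a t := by
      simpa using (hasDerivAt_id t).const_mul a
    exact h1.exp
  set U : ℝ → ℝ := fun t => Real.exp ((δ + 1) * t) * -v (Real.exp t) with hU
  have hUpos : ∀ t ≥ T, 0 < U t := fun t ht =>
    mul_pos (Real.exp_pos _) (neg_pos.2 (hv _ (hTs t ht)))
  have hUP : ∀ t ≥ T, U t ^ (p - 1) = Real.exp ((δ - 1) * t) * -phiP p (v (Real.exp t)) := by
    intro t ht
    have hvt := hv _ (hTs t ht)
    rw [phiP_of_neg hvt, neg_neg, hU, Real.mul_rpow (Real.exp_pos _).le (by linarith),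
      ← Real.exp_mul, mul_right_comm, hδp]
  refine ⟨α * (q - 1), T + 1, U, fun t => w (Real.exp t) ^ (q - 1), hp, hp2, hα, hαδ,
    mul_pos hα (by linarith), ?_, ?_, ?_, ?_, ?_, ?_, ?_⟩
  · intro t ht
    exact mul_pos (Real.exp_pos _) (hw _ (hTr t (by linarith)))
  · intro t ht
    exact hUpos t (by linarith)
  · intro t ht
    exact Real.rpow_nonneg (hw _ (hTr t (by linarith))).le _
  · intro t ht
    have hwt := hw _ (hTr t (by linarith))
    have h1 := (hT t (by linarith)).2
    simp only [Function.comp_apply] at h1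
    rw [← Real.exp_mul] at h1
    have h2 : w (Real.exp t) ≤ Real.exp (-α * t) := by
      have h3 := mul_le_mul_of_nonneg_left h1 (Real.exp_pos (-α * t)).le
      rw [← mul_assoc, ← Real.exp_add, mul_one] at h3
      have h4 : -α * t + t * α = 0 := by ring
      rwa [h4, Real.exp_zero, one_mul] at h3
    refine (Real.rpow_le_rpow hwt.le h2 (by linarith)).trans (le_of_eq ?_)
    rw [← Real.exp_mul]
    congr 1
    ring
  · intro t ht
    have h1 := (h.hasDerivAt _ (hTr t (by linarith))).comp t (Real.hasDerivAt_exp t)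
    refine ((hE δ t).mul h1).congr_deriv ?_
    simp only [hU, Function.comp_apply]
    rw [add_mul, one_mul, Real.exp_add]
    ring
  · intro t ht
    have hr := hTr t (by linarith)
    have hwt := hw _ hr
    have h1 := ((h.hasDerivAt_phiP _ hr).comp t (Real.hasDerivAt_exp t)).neg
    have h2 := (hE (δ - 1) t).mul h1
    have h3 : (fun t => U t ^ (p - 1)) =ᶠ[𝓝 t]
        fun t => Real.exp ((δ - 1) * t) * -phiP p (v (Real.exp t)) := by
      filter_upwards [lt_mem_nhds (show T < t by linarith)] with x hx using hUP x hx.le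
    refine (HasDerivAt.congr_of_eventuallyEq h2 h3).congr_deriv ?_
    rw [hUP t (by linarith), abs_of_pos hwt]
    simp only [hU, Function.comp_apply, Pi.neg_apply]
    have e1 : Real.exp (δ * t) = Real.exp ((δ - 1) * t) * Real.exp t := by
      rw [← Real.exp_add]; ring_nf
    have e2 : Real.exp ((δ + 1) * t) = Real.exp ((δ - 1) * t) * Real.exp t * Real.exp t := by
      rw [← Real.exp_add, ← Real.exp_add]; ring_nf
    have e3 := Real.exp_pos t
    rw [e1, e2]
    field_simp
    ring
  · refine (h0.comp Real.tendsto_exp_atTop).congr fun t => ?_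
    simp only [Function.comp_apply]
    rw [← mul_assoc, ← Real.exp_add, ← Real.exp_mul]
    ring_nf

/-- The three asymptotic regimes for positive solutions. -/
lemma limits_of_pos {N : ℕ} (h : SolvesBeyond N p q α r₁ w v) (hN : 1 ≤ N) (hp : 1 < p)
    (hp2 : p < 2) (hq : 1 < q) (hα : 0 < α) (hαδ : α < p / (2 - p)) (hw : ∀ r > r₁, 0 < w r)
    (h0 : Tendsto (fun r => r ^ α * w r) atTop (𝓝 0)) :
    (2 * (N : ℝ) / (N + 1) < p →
      Tendsto (fun r => r ^ (p / (2 - p)) * w r) atTop (𝓝 (((p / (2 - p)) ^ (p - 1) *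
        ((p / (2 - p) - N) / (p / (2 - p) - α))) ^ (1 / (2 - p))))) ∧
    (p < 2 * (N : ℝ) / (N + 1) →
      ∃ c : ℝ, c ≠ 0 ∧ Tendsto (fun r => r ^ (((N : ℝ) - p) / (p - 1)) * w r) atTop (𝓝 c)) ∧
    (p = 2 * (N : ℝ) / (N + 1) →
      Tendsto (fun r => r ^ (N : ℝ) * Real.log r ^ (((N : ℝ) + 1) / 2) * w r) atTop
        (𝓝 ((1 / N) * (((N : ℝ) * (N - 1)) / (2 * ((N : ℝ) - α))) ^ (((N : ℝ) + 1) / 2)))) := by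
  obtain ⟨k, T, U, ε, hF⟩ := h.exists_logFlow hp hp2 hq hα hαδ hw h0
  have hNpos : (0 : ℝ) < N := by exact_mod_cast hN
  have h2p : 0 < 2 - p := by linarith
  have hp1 : 0 < p - 1 := by linarith
  refine ⟨fun hc => ?_, fun hc => ?_, fun hc => ?_⟩
  · have hn : (N : ℝ) < p / (2 - p) := by
      rw [div_lt_iff₀ (by positivity)] at hc
      rw [lt_div_iff₀ h2p]; linarith
    refine ((hF.tendsto_V_of_lt hn).comp Real.tendsto_log_atTop).congr' ?_
    filter_upwards [eventually_gt_atTop 0] with r hr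
    simp only [Function.comp_apply]
    rw [Real.exp_log hr, Real.rpow_def_of_pos hr, mul_comm (Real.log r)]
  · have hn : p / (2 - p) < N := by
      rw [lt_div_iff₀ (by positivity)] at hc
      rw [div_lt_iff₀ h2p]; linarith
    obtain ⟨c, hcpos, hlim⟩ := hF.exists_tendsto_of_gt hn
    refine ⟨c, hcpos.ne', (hlim.comp Real.tendsto_log_atTop).congr' ?_⟩
    filter_upwards [eventually_gt_atTop 0] with r hr
    simp only [Function.comp_apply]
    rw [Real.exp_log hr, Real.rpow_def_of_pos hr, ← mul_assoc, ← Real.exp_add]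
    congr 2
    field_simp
    ring
  · have hn : p / (2 - p) = N := by
      rw [eq_div_iff (by positivity)] at hc
      rw [div_eq_iff h2p.ne']; linarith
    have hN1 : (0 : ℝ) < N - 1 := by
      rw [eq_div_iff (by positivity)] at hc
      nlinarith
    have he : 1 / (2 - p) = ((N : ℝ) + 1) / 2 := by
      rw [hc]; field_simp; ring
    have hκ : (2 - p) / (p - 1) = 2 / ((N : ℝ) - 1) := by
      rw [div_eq_div_iff hp1.ne' hN1.ne', hc]; field_simp; ring
    have hNα : 0 < (N : ℝ) - α := by rw [← hn]; linarith
    have hlim := hF.tendsto_V_of_eq hn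
    rw [he, hκ, Real.rpow_neg (by positivity), ← Real.inv_rpow (by positivity),
      show (2 / ((N : ℝ) - 1) * ((N - α) / N))⁻¹ = (N : ℝ) * (N - 1) / (2 * (N - α)) by
        field_simp] at hlim
    refine (hlim.comp Real.tendsto_log_atTop).congr' ?_
    filter_upwards [eventually_gt_atTop 0] with r hr
    simp only [Function.comp_apply]
    rw [Real.exp_log hr, Real.rpow_def_of_pos hr, hn, mul_comm (Real.log r)]
    ring

end SolvesBeyond

lemma IsSolutionOn.solvesBeyond {N : ℕ} {p q α r₀ : ℝ} {w : ℝ → ℝ}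
    (hw : IsSolutionOn N p q α w (Ici r₀)) :
    SolvesBeyond N p q α r₀ w (derivWithin w (Ici r₀)) := by
  obtain ⟨h1, h2, h3⟩ := hw
  refine ⟨fun r hr => ?_, fun r hr => ?_⟩
  · exact ((h1.differentiableOn one_ne_zero r hr.le).hasDerivWithinAt).hasDerivAt (Ici_mem_nhds hr)
  · refine (((h2.differentiableOn one_ne_zero r hr.le).hasDerivWithinAt).hasDerivAt
      (Ici_mem_nhds hr)).congr_deriv ?_
    linarith [h3 r hr.le]

/-- A continuous function with finitely many zeros on a half-line has eventually constant sign. -/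
lemma eventually_pos_or_neg_of_finite_zeros {w : ℝ → ℝ} {r₀ : ℝ} (hw : ContinuousOn w (Ici r₀))
    (hz : {r : ℝ | r ∈ Ici r₀ ∧ w r = 0}.Finite) :
    ∃ R ≥ r₀, (∀ r ≥ R, 0 < w r) ∨ ∀ r ≥ R, w r < 0 := by
  obtain ⟨B, hB⟩ := hz.bddAbove
  set R := max r₀ (B + 1)
  have hRr : r₀ ≤ R := le_max_left _ _
  have hne : ∀ r ≥ R, w r ≠ 0 := fun r hr h0 => by
    have h1 := hB ⟨le_trans hRr hr, h0⟩
    have h2 : B + 1 ≤ R := le_max_right _ _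
    linarith
  have hcont : ∀ r, ContinuousOn w (Icc R r) := fun r =>
    hw.mono fun x hx => hRr.trans hx.1
  refine ⟨R, hRr, ?_⟩
  rcases (hne R le_rfl).lt_or_gt with hR | hR
  · refine Or.inr fun r hr => ?_
    by_contra! hcon
    obtain ⟨x, hx, hx0⟩ := intermediate_value_Icc hr (hcont r) ⟨hR.le, hcon⟩
    exact hne x hx.1 hx0
  · refine Or.inl fun r hr => ?_
    by_contra! hcon
    obtain ⟨x, hx, hx0⟩ := intermediate_value_Icc' hr (hcont r) ⟨hcon, hR.le⟩
    exact hne x hx.1 hx0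

/-- Assume `p < 2`, `α < δ`. Let `w` solve (E) on `[r₀,∞)` with
`lim r^α w = 0` and finitely many zeros. Then: (i) if `p₁ < p`,
`r^δ w → ±ℓ`; (ii) if `p < p₁`, `r^η w → c ≠ 0`; (iii) if `p = p₁`,
`r^N (ln r)^{(N+1)/2} w → ±ϱ` with `ϱ = (1/N)(N(N-1)/(2(N-α)))^{(N+1)/2}`. -/
theorem stmt10 (N : ℕ) (hN : 1 ≤ N) (p q α : ℝ) (hp : 1 < p) (hp2 : p < 2) (hq : 1 < q)
    (hα : 0 < α) (hαδ : α < p / (2 - p))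
    (r₀ : ℝ) (hr₀ : 0 < r₀) (w : ℝ → ℝ) (hw : IsSolutionOn N p q α w (Ici r₀))
    (h0 : Tendsto (fun r => r ^ α * w r) atTop (𝓝 0))
    (hz : {r : ℝ | r ∈ Ici r₀ ∧ w r = 0}.Finite) :
    (2 * (N : ℝ) / (N + 1) < p →
      Tendsto (fun r => r ^ (p / (2 - p)) * w r) atTop
        (𝓝 (((p / (2 - p)) ^ (p - 1) * ((p / (2 - p) - N) / (p / (2 - p) - α))) ^ (1 / (2 - p)))) ∨
      Tendsto (fun r => r ^ (p / (2 - p)) * w r) atTop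
        (𝓝 (-(((p / (2 - p)) ^ (p - 1) * ((p / (2 - p) - N) / (p / (2 - p) - α))) ^ (1 / (2 - p)))))) ∧
    (p < 2 * (N : ℝ) / (N + 1) →
      ∃ c : ℝ, c ≠ 0 ∧ Tendsto (fun r => r ^ (((N : ℝ) - p) / (p - 1)) * w r) atTop (𝓝 c)) ∧
    (p = 2 * (N : ℝ) / (N + 1) →
      Tendsto (fun r => r ^ (N : ℝ) * Real.log r ^ (((N : ℝ) + 1) / 2) * w r) atTop
        (𝓝 ((1 / N) * (((N : ℝ) * (N - 1)) / (2 * ((N : ℝ) - α))) ^ (((N : ℝ) + 1) / 2))) ∨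
      Tendsto (fun r => r ^ (N : ℝ) * Real.log r ^ (((N : ℝ) + 1) / 2) * w r) atTop
        (𝓝 (-((1 / N) * (((N : ℝ) * (N - 1)) / (2 * ((N : ℝ) - α))) ^ (((N : ℝ) + 1) / 2))))) := by
  obtain ⟨R, hR, hsign⟩ := eventually_pos_or_neg_of_finite_zeros hw.1.continuousOn hz
  have hS := hw.solvesBeyond.mono hR
  rcases hsign with hpos | hneg
  · obtain ⟨h1, h2, h3⟩ := hS.limits_of_pos hN hp hp2 hq hα hαδ (fun r hr => hpos r hr.le) h0
    exact ⟨fun h => Or.inl (h1 h), h2, fun h => Or.inl (h3 h)⟩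
  · obtain ⟨h1, h2, h3⟩ := hS.neg.limits_of_pos hN hp hp2 hq hα hαδ
      (fun r hr => neg_pos.2 (hneg r hr.le)) (by simpa using h0.neg)
    refine ⟨fun h => Or.inr ?_, fun h => ?_, fun h => Or.inr ?_⟩
    · simpa using (h1 h).neg
    · obtain ⟨c, hc, hlim⟩ := h2 h
      exact ⟨-c, neg_ne_zero.2 hc, by simpa using hlim.neg⟩
    · have := (h3 h).neg
      simp only [mul_neg, neg_neg] at this
      exact this
end
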